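/- For all constants c > 0 and d ≥ 1 there exists a constant C such that the following holds. Let (X,S) be a finite set system with n = |X| ≥ 2 whose dual shatter function satisfies π*_S(k) ≤ c·k^d for all k, let α ∈ (0,1] and δ ∈ (0,1), and let E be a random subset of the edge set binom(X,2) in which each edge is included independently with probability p = min{ 2·ln n / n^{1−α} + 4·ln(2/δ) / n^{2−α} , 1 }. Then with probability at least 1 − δ, E contains a matching of size ⌊n/4⌋ whose crossing number with respect to S is at most C·( n^{1−α/d} + ln |S| ). -/

import Mathlib

open Finset
open scoped Classical

/-- The edge sampling probability `p = min{2·ln n/n^{1−α} + 4·ln(2/δ)/n^{2−α}, 1}`. -/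
noncomputable def pEdge (n : ℕ) (α δ : ℝ) : ℝ :=
  min (2 * Real.log n / (n : ℝ) ^ (1 - α) + 4 * Real.log (2 / δ) / (n : ℝ) ^ (2 - α)) 1


lemma union_bound {β ι : Type*} (E : Finset β) (p : ℝ) (hp0 : 0 ≤ p) (hp1 : p ≤ 1)
    (good : Finset β → Prop) (I : Finset ι) (A : ι → Finset β)
    (hA : ∀ i ∈ I, A i ⊆ E)
    (h : ∀ F ⊆ E, ¬ good F → ∃ i ∈ I, Disjoint F (A i)) :
    1 - ∑ i ∈ I, (1 - p) ^ (A i).card ≤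
      ∑ F ∈ E.powerset, (if good F then p ^ F.card * (1 - p) ^ (E.card - F.card) else 0) := by
  have hq : 0 ≤ 1 - p := by linarith
  have h1 : ∑ F ∈ E.powerset, p ^ F.card * (1 - p) ^ (E.card - F.card) = 1 := by
    rw [Finset.sum_pow_mul_eq_add_pow]; simp
  have h2 : ∀ i ∈ I, ∑ F ∈ E.powerset,
      (if Disjoint F (A i) then p ^ F.card * (1 - p) ^ (E.card - F.card) else 0)
      = (1 - p) ^ (A i).card := by
    intro i hi
    rw [← Finset.sum_filter]
    have e : E.powerset.filter (fun F => Disjoint F (A i)) = (E \ A i).powerset := by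
      ext F
      simp only [mem_filter, mem_powerset, Finset.subset_sdiff]
    rw [e]
    have e2 : ∀ F ∈ (E \ A i).powerset, p ^ F.card * (1 - p) ^ (E.card - F.card)
        = (1 - p) ^ (A i).card * (p ^ F.card * (1 - p) ^ ((E \ A i).card - F.card)) := by
      intro F hF
      have hF' := Finset.card_le_card (mem_powerset.1 hF)
      have hc := Finset.card_sdiff_add_card_eq_card (hA i hi)
      have : E.card - F.card = (A i).card + ((E \ A i).card - F.card) := by omega
      rw [this, pow_add]; ring
    rw [Finset.sum_congr rfl e2, ← Finset.mul_sum, Finset.sum_pow_mul_eq_add_pow]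
    simp
  have h3 : 1 ≤ ∑ F ∈ E.powerset, (if good F then p ^ F.card * (1 - p) ^ (E.card - F.card) else 0)
      + ∑ i ∈ I, ∑ F ∈ E.powerset,
      (if Disjoint F (A i) then p ^ F.card * (1 - p) ^ (E.card - F.card) else 0) := by
    rw [Finset.sum_comm, ← Finset.sum_add_distrib]
    refine h1.symm.le.trans ?_
    apply Finset.sum_le_sum
    intro F hF
    have hw : 0 ≤ p ^ F.card * (1 - p) ^ (E.card - F.card) := by positivity
    have hn : 0 ≤ ∑ i ∈ I, (if Disjoint F (A i) then p ^ F.card * (1 - p) ^ (E.card - F.card) else 0) :=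
      Finset.sum_nonneg (fun i _ => by split_ifs <;> simp [hw])
    by_cases hg : good F
    · simp only [hg, if_true]; linarith
    · obtain ⟨i, hi, hd⟩ := h F (mem_powerset.1 hF) hg
      have := Finset.single_le_sum (f := fun i => (if Disjoint F (A i) then p ^ F.card * (1 - p) ^ (E.card - F.card) else 0)) (fun i _ => by split_ifs <;> simp [hw]) hi
      simp only [hd, if_true] at this
      simp only [hg, if_false]; linarith
  rw [Finset.sum_congr rfl h2] at h3
  linarith

/-- number of unit-distance edges in direction `a` -/
noncomputable def edg {α : Type*} [DecidableEq α] (𝒜 : Finset (Finset α)) (a : α) : ℕ :=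
  (𝒜.filter (fun A => a ∉ A ∧ insert a A ∈ 𝒜)).card

lemma edg_split {α : Type*} [DecidableEq α] (𝒜 : Finset (Finset α)) (a g : α) (h : a ≠ g) :
    edg 𝒜 a ≤ edg (𝒜.nonMemberSubfamily g ∪ 𝒜.memberSubfamily g) a
      + edg (𝒜.nonMemberSubfamily g ∩ 𝒜.memberSubfamily g) a := by
  set A0 := 𝒜.nonMemberSubfamily g with hA0
  set A1 := 𝒜.memberSubfamily g with hA1
  have hga : ∀ A : Finset α, g ∈ insert a A ↔ g ∈ A := by
    intro A; simp [h.symm]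
  set E0 := A0.filter (fun A => a ∉ A ∧ insert a A ∈ A0)
  set E1 := A1.filter (fun A => a ∉ A ∧ insert a A ∈ A1)
  have h1 : edg 𝒜 a ≤ E0.card + E1.card := by
    unfold edg
    have : 𝒜.filter (fun A => a ∉ A ∧ insert a A ∈ 𝒜) ⊆ E0 ∪ E1.image (fun A : Finset α => insert g A) := by
      intro A hA
      simp only [mem_filter] at hA
      obtain ⟨hA, ha, hi⟩ := hA
      by_cases hg : g ∈ A
      · apply mem_union_right
        rw [mem_image]
        refine ⟨A.erase g, ?_, Finset.insert_erase hg⟩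
        simp only [E1, mem_filter, hA1, mem_memberSubfamily, Finset.insert_erase hg, hA]
        rw [Finset.insert_comm, Finset.insert_erase hg]
        simp [hi, ha, h.symm]
      · apply mem_union_left
        simp only [E0, mem_filter, hA0, mem_nonMemberSubfamily, hga]
        exact ⟨⟨hA, hg⟩, ha, hi, hg⟩
    calc (𝒜.filter (fun A => a ∉ A ∧ insert a A ∈ 𝒜)).card ≤ (E0 ∪ E1.image (fun A : Finset α => insert g A)).card := card_le_card this
      _ ≤ E0.card + (E1.image (fun A : Finset α => insert g A)).card := card_union_le _ _
      _ ≤ _ := Nat.add_le_add_left card_image_le _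
  have h2 : E0 ∪ E1 ⊆ (A0 ∪ A1).filter (fun A => a ∉ A ∧ insert a A ∈ A0 ∪ A1) := by
    intro A; simp only [E0, E1, mem_union, mem_filter]; tauto
  have h3 : E0 ∩ E1 ⊆ (A0 ∩ A1).filter (fun A => a ∉ A ∧ insert a A ∈ A0 ∩ A1) := by
    intro A; simp only [E0, E1, mem_inter, mem_filter]; tauto
  calc _ ≤ E0.card + E1.card := h1
    _ = (E0 ∪ E1).card + (E0 ∩ E1).card := (card_union_add_card_inter _ _).symm
    _ ≤ _ := add_le_add (card_le_card h2) (card_le_card h3)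

lemma density {α : Type*} [DecidableEq α] (G : Finset α) : ∀ (d : ℕ) (𝒜 : Finset (Finset α)),
    (∀ A ∈ 𝒜, A ⊆ G) → (∀ B, 𝒜.Shatters B → B.card ≤ d) →
    ∑ a ∈ G, edg 𝒜 a ≤ d * 𝒜.card := by
  induction G using Finset.induction_on with
  | empty => intro d 𝒜 _ _; simp
  | insert g G hg ih =>
    intro d 𝒜 hsub hsh
    rw [Finset.sum_insert hg]
    set A0 := 𝒜.nonMemberSubfamily g with hA0
    set A1 := 𝒜.memberSubfamily g with hA1
    have hg1 : edg 𝒜 g = (A0 ∩ A1).card := by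
      unfold edg
      congr 1
      ext A
      simp only [hA0, hA1, mem_filter, mem_inter, mem_nonMemberSubfamily, mem_memberSubfamily]
      tauto
    have hcard : 𝒜.card = (A0 ∪ A1).card + (A0 ∩ A1).card := by
      rw [card_union_add_card_inter, add_comm, card_memberSubfamily_add_card_nonMemberSubfamily]
    have hs1 : ∀ A ∈ A0 ∪ A1, A ⊆ G := by
      intro A hA x hx
      simp only [hA0, hA1, mem_union, mem_nonMemberSubfamily, mem_memberSubfamily] at hA
      rcases hA with ⟨h1, h2⟩ | ⟨h1, h2⟩
      · have := hsub _ h1 hx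
        rw [mem_insert] at this
        rcases this with rfl | h
        · exact absurd hx h2
        · exact h
      · have := hsub _ h1 (mem_insert_of_mem hx)
        rw [mem_insert] at this
        rcases this with rfl | h
        · exact absurd hx h2
        · exact h
    have hv1 : ∀ B, (A0 ∪ A1).Shatters B → B.card ≤ d := by
      intro B hB
      apply hsh
      have hgB : g ∉ B := by
        intro hgB
        obtain ⟨u, hu, he⟩ := hB (Finset.Subset.refl B)
        have : g ∈ B ∩ u := by rw [he]; exact hgB
        exact hg (hs1 u hu (mem_inter.1 this).2)
      intro t ht
      obtain ⟨u, hu, he⟩ := hB ht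
      simp only [hA0, hA1, mem_union, mem_nonMemberSubfamily, mem_memberSubfamily] at hu
      rcases hu with ⟨h1, h2⟩ | ⟨h1, h2⟩
      · exact ⟨u, h1, he⟩
      · exact ⟨_, h1, by rw [Finset.inter_insert_of_notMem hgB, he]⟩
    have hv2 : ∀ B, (A0 ∩ A1).Shatters B → B.card + 1 ≤ d := by
      intro B hB
      have hgB : g ∉ B := by
        intro hgB
        obtain ⟨u, hu, he⟩ := hB (Finset.Subset.refl B)
        have : g ∈ B ∩ u := by rw [he]; exact hgB
        exact hg (hs1 u (mem_union_left _ (mem_inter.1 hu).1) (mem_inter.1 this).2)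
      rw [← card_insert_of_notMem hgB]
      apply hsh
      intro t ht
      obtain ⟨u, hu, he⟩ := hB (t := t.erase g) (by
        intro x hx
        have := ht (mem_of_mem_erase hx)
        rw [mem_insert] at this
        exact this.resolve_left (ne_of_mem_erase hx))
      simp only [hA0, hA1, mem_inter, mem_nonMemberSubfamily, mem_memberSubfamily] at hu
      by_cases hgt : g ∈ t
      · refine ⟨_, hu.2.1, ?_⟩
        rw [← Finset.insert_inter_distrib, he, insert_erase hgt]
      · refine ⟨_, hu.1.1, ?_⟩
        rw [Finset.insert_inter_of_notMem hu.1.2, he, erase_eq_of_notMem hgt]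
    have i1 := ih d (A0 ∪ A1) hs1 hv1
    have hsum : ∑ a ∈ G, edg 𝒜 a ≤ ∑ a ∈ G, edg (A0 ∪ A1) a + ∑ a ∈ G, edg (A0 ∩ A1) a := by
      rw [← sum_add_distrib]
      apply sum_le_sum
      intro a ha
      exact edg_split 𝒜 a g (fun h => hg (h ▸ ha))
    rw [hg1, hcard]
    rcases (A0 ∩ A1).eq_empty_or_nonempty with he | hne
    · have : ∑ a ∈ G, edg (A0 ∩ A1) a = 0 := by rw [he]; simp [edg]
      rw [this] at hsum
      rw [he]; simp; omega
    · obtain ⟨d', rfl⟩ : ∃ d', d = d' + 1 := by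
        have := hv2 ∅ (by
          intro t ht
          obtain ⟨u, hu⟩ := hne
          exact ⟨u, hu, by simpa using (subset_empty.1 ht).symm⟩)
        exact ⟨d - 1, by omega⟩
      have i2 := ih d' (A0 ∩ A1) (fun A hA => hs1 A (mem_union_left _ (mem_inter.1 hA).1))
        (fun B hB => by have := hv2 B hB; omega)
      nlinarith

noncomputable def pat {V T : Type*} {s : ℕ} (ρ : V → T → Prop) (r : Fin s → T) (x : V) :
    Finset (Fin s) := univ.filter (fun i => ρ x (r i))

noncomputable def wt {V : Type*} {s : ℕ} (P : Finset V) (q : V → Finset (Fin s))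
    (A : Finset (Fin s)) : ℕ := (P.filter (fun x => q x = A)).card

lemma layer {V : Type*} {s : ℕ} (P : Finset V) (q : V → Finset (Fin s)) (d0 : ℕ)
    (hv : ∀ B, (P.image q).Shatters B → B.card ≤ d0) :
    ∑ i : Fin s, ∑ A ∈ univ.filter (fun A : Finset (Fin s) => i ∉ A),
      min (wt P q A) (wt P q (insert i A)) ≤ d0 * P.card := by
  set N := P.card
  have hN : ∀ A, wt P q A ≤ N := fun A => card_le_card (filter_subset _ _)
  let Lv : ℕ → Finset (Finset (Fin s)) := fun τ => univ.filter (fun A => τ < wt P q A)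
  have h1 : ∀ a b : ℕ, a ≤ N → min a b = ∑ τ ∈ range N, if τ < a ∧ τ < b then 1 else 0 := by
    intro a b ha
    rw [← Finset.card_filter]
    have : (range N).filter (fun τ => τ < a ∧ τ < b) = range (min a b) := by
      ext τ; simp only [mem_filter, mem_range, lt_min_iff]; omega
    rw [this, card_range]
  have h2 : ∀ τ, ∑ i : Fin s, edg (Lv τ) i ≤ d0 * (Lv τ).card := by
    intro τ
    apply density univ d0 (Lv τ) (fun A _ => subset_univ _)
    intro B hB
    apply hv
    intro t ht
    obtain ⟨u, hu, he⟩ := hB ht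
    refine ⟨u, ?_, he⟩
    have : 0 < wt P q u := by
      have := (mem_filter.1 hu).2; omega
    obtain ⟨x, hx⟩ := card_pos.1 this
    rw [mem_filter] at hx
    exact mem_image.2 ⟨x, hx.1, hx.2⟩
  have h3 : ∑ τ ∈ range N, (Lv τ).card = N := by
    simp only [Lv, Finset.card_filter]
    rw [Finset.sum_comm]
    have : ∀ A : Finset (Fin s), (∑ τ ∈ range N, if τ < wt P q A then 1 else 0) = wt P q A := by
      intro A
      have := h1 (wt P q A) (wt P q A) (hN A)
      simpa using this.symm
    rw [Finset.sum_congr rfl (fun A _ => this A)]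
    unfold wt
    rw [← Finset.card_eq_sum_card_fiberwise]
    intro x _; simp
  calc _ = ∑ i : Fin s, ∑ τ ∈ range N, edg (Lv τ) i := by
        apply sum_congr rfl
        intro i _
        rw [sum_congr rfl (fun A _ => h1 (wt P q A) (wt P q (insert i A)) (hN A)), sum_comm]
        apply sum_congr rfl
        intro τ _
        rw [← Finset.card_filter, edg]
        congr 1
        ext A
        simp only [mem_filter, mem_univ, true_and, Lv]
        tauto
    _ = ∑ τ ∈ range N, ∑ i : Fin s, edg (Lv τ) i := sum_comm
    _ ≤ ∑ τ ∈ range N, d0 * (Lv τ).card := sum_le_sum (fun τ _ => h2 τ)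
    _ = d0 * N := by rw [← mul_sum, h3]

lemma min_ge (a b c : ℝ) (ha : 0 ≤ a) (hb : 0 ≤ b) (hc : a + b ≤ c) : a * (b / c) ≤ min a b := by
  rcases eq_or_lt_of_le (show 0 ≤ c by linarith) with h | h
  · rw [← h]; simp [ha, hb]
  · rw [← mul_div_assoc, le_min_iff, div_le_iff₀ h, div_le_iff₀ h]
    constructor <;> nlinarith

lemma edge_lower {V T : Type*} {s : ℕ} (P : Finset V) (ρ : V → T → Prop) (r : Fin s → T) (t : T)
    (i : Fin (s+1)) :
    ∑ x ∈ P, ∑ y ∈ P, (if pat ρ r x = pat ρ r y ∧ (¬ ρ x t ∧ ρ y t) then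
        (1 : ℝ) / (wt P (pat ρ r) (pat ρ r x)) else 0)
    ≤ ∑ A ∈ univ.filter (fun A : Finset (Fin (s+1)) => i ∉ A),
      ((min (wt P (pat ρ (i.insertNth t r : Fin (s+1) → T)) A)
        (wt P (pat ρ (i.insertNth t r : Fin (s+1) → T)) (insert i A)) : ℕ) : ℝ) := by
  set R : Fin (s+1) → T := i.insertNth t r with hR
  have hi : ∀ x, i ∈ pat ρ R x ↔ ρ x t := by
    intro x; simp [pat, hR]
  have hj : ∀ x (j : Fin s), i.succAbove j ∈ pat ρ R x ↔ j ∈ pat ρ r x := by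
    intro x j; simp [pat, hR]
  have hsame : ∀ x y, pat ρ r x = pat ρ r y → ¬ ρ x t → ρ y t → pat ρ R y = insert i (pat ρ R x) := by
    intro x y h hx hy
    ext k
    refine Fin.succAboveCases i ?_ (fun j => ?_) k
    · simp [hi, hy]
    · rw [mem_insert, hj, hj, h]; simp [Fin.succAbove_ne]
  have hrest : ∀ x y, (pat ρ R y = pat ρ R x ∨ pat ρ R y = insert i (pat ρ R x)) →
      pat ρ r y = pat ρ r x := by
    intro x y h
    ext j
    rw [← hj, ← hj]
    rcases h with h | h
    · rw [h]
    · rw [h, mem_insert]; simp [Fin.succAbove_ne]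
  rw [← Finset.sum_fiberwise P (pat ρ R)]
  rw [Finset.sum_filter]
  apply sum_le_sum
  intro A _
  by_cases hA : i ∈ A
  · simp only [hA, not_true_eq_false, if_false]
    apply le_of_eq
    apply sum_eq_zero
    intro x hx
    apply sum_eq_zero
    intro y _
    rw [mem_filter] at hx
    have : ρ x t := by rw [← hi, hx.2]; exact hA
    simp [this]
  · simp only [hA, not_false_eq_true, if_true]
    have hb : ∀ x ∈ P.filter (fun x => pat ρ R x = A), wt P (pat ρ R) A + wt P (pat ρ R) (insert i A) ≤ wt P (pat ρ r) (pat ρ r x) := by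
      intro x hx
      rw [mem_filter] at hx
      unfold wt
      rw [← card_union_of_disjoint]
      · apply card_le_card
        intro y hy
        simp only [mem_union, mem_filter] at hy ⊢
        rw [← hx.2] at hy
        have := hrest x y
        tauto
      · rw [Finset.disjoint_left]
        intro y hy hy'
        simp only [mem_filter] at hy hy'
        have : A = insert i A := hy.2.symm.trans hy'.2
        exact hA (by rw [this]; simp)
    calc _ ≤ ∑ x ∈ P.filter (fun x => pat ρ R x = A), min (wt P (pat ρ R) A : ℝ) (wt P (pat ρ R) (insert i A)) / wt P (pat ρ R) A := by
          apply sum_le_sum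
          intro x hx
          have hb' := hb x hx
          have hb'' : (wt P (pat ρ R) A : ℝ) + wt P (pat ρ R) (insert i A) ≤ wt P (pat ρ r) (pat ρ r x) := by exact_mod_cast hb'
          have hx' := mem_filter.1 hx
          have hpos : 0 < wt P (pat ρ R) A := card_pos.2 ⟨x, hx⟩
          rw [le_div_iff₀ (by exact_mod_cast hpos), mul_comm]
          refine le_trans ?_ (min_ge _ _ _ (by positivity) (by positivity) hb'')
          gcongr
          rw [← Finset.sum_filter, sum_const, nsmul_eq_mul, mul_one_div]
          gcongr
          unfold wt
          apply card_le_card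
          intro y hy
          simp only [mem_filter] at hy ⊢
          refine ⟨hy.1, ?_⟩
          rw [← hx'.2]
          exact hsame x y hy.2.1 hy.2.2.1 hy.2.2.2
      _ ≤ _ := by
          rw [sum_const, nsmul_eq_mul, Nat.cast_min]
          change (wt P (pat ρ R) A : ℝ) * _ ≤ _
          rcases Nat.eq_zero_or_pos (wt P (pat ρ R) A) with h | h
          · rw [h]; simp
          · rw [mul_div_cancel₀]
            exact_mod_cast h.ne'

lemma sum_inv_class {V : Type*} {s : ℕ} (P : Finset V) (q : V → Finset (Fin s)) :
    ∑ x ∈ P, (1 : ℝ) / wt P q (q x) = (P.image q).card := by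
  rw [← Finset.sum_fiberwise_of_maps_to (t := P.image q) (g := q) (fun x hx => mem_image_of_mem _ hx)]
  rw [Finset.card_eq_sum_ones, Nat.cast_sum]
  apply sum_congr rfl
  intro A hA
  have : ∀ x ∈ P.filter (fun x => q x = A), (1 : ℝ) / wt P q (q x) = 1 / wt P q A := by
    intro x hx; rw [(mem_filter.1 hx).2]
  rw [sum_congr rfl this, sum_const, nsmul_eq_mul, mul_one_div]
  change (wt P q A : ℝ) / _ = _
  rw [Nat.cast_one, div_self]
  obtain ⟨x, hx, h⟩ := mem_image.1 hA
  have : 0 < wt P q A := card_pos.2 ⟨x, mem_filter.2 ⟨hx, h⟩⟩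
  exact_mod_cast this.ne'

lemma avg_lower {V T : Type*} [Fintype T] {s : ℕ} (P : Finset V) (ρ : V → T → Prop) (r : Fin s → T)
    (μ : T → ℝ) (ε : ℝ) 
    (hsep : ∀ x ∈ P, ∀ y ∈ P, x ≠ y → ε ≤ ∑ t, if (ρ x t ↔ ρ y t) then 0 else μ t) :
    ε / 2 * (P.card - (P.image (pat ρ r)).card) ≤
    ∑ t, μ t * ∑ x ∈ P, ∑ y ∈ P, (if pat ρ r x = pat ρ r y ∧ (¬ ρ x t ∧ ρ y t) then
        (1 : ℝ) / (wt P (pat ρ r) (pat ρ r x)) else 0) := by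
  set b : V → ℝ := fun x => wt P (pat ρ r) (pat ρ r x) with hb
  let D : V → V → ℝ := fun x y => ∑ t, if ¬ ρ x t ∧ ρ y t then μ t else 0
  have hD : ∀ x y, D x y + D y x = ∑ t, if (ρ x t ↔ ρ y t) then 0 else μ t := by
    intro x y
    simp only [D]
    rw [← sum_add_distrib]
    apply sum_congr rfl
    intro t _
    by_cases h1 : ρ x t <;> by_cases h2 : ρ y t <;> simp [h1, h2]
  have e1 : ∑ t, μ t * ∑ x ∈ P, ∑ y ∈ P, (if pat ρ r x = pat ρ r y ∧ (¬ ρ x t ∧ ρ y t) then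
        (1 : ℝ) / b x else 0) = ∑ x ∈ P, ∑ y ∈ P, if pat ρ r x = pat ρ r y then D x y / b x else 0 := by
    simp only [mul_sum]
    rw [sum_comm]
    apply sum_congr rfl
    intro x _
    rw [sum_comm]
    apply sum_congr rfl
    intro y _
    by_cases h : pat ρ r x = pat ρ r y
    · simp only [h, true_and, if_true, D, sum_div]
      apply sum_congr rfl
      intro t _
      split_ifs <;> simp [div_eq_mul_inv]
    · simp [h]
  have e2 : ∑ x ∈ P, ∑ y ∈ P, (if pat ρ r x = pat ρ r y then D x y / b x else 0)
      = ∑ x ∈ P, ∑ y ∈ P, if pat ρ r x = pat ρ r y then D y x / b x else 0 := by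
    rw [sum_comm]
    apply sum_congr rfl
    intro x _
    apply sum_congr rfl
    intro y _
    by_cases h : pat ρ r x = pat ρ r y
    · simp [h, hb]
    · simp [h, Ne.symm h]
  have e3 : ∑ x ∈ P, ε * (1 - 1 / b x) ≤ ∑ x ∈ P, ∑ y ∈ P, (if pat ρ r x = pat ρ r y then D x y / b x else 0)
      + ∑ x ∈ P, ∑ y ∈ P, (if pat ρ r x = pat ρ r y then D y x / b x else 0) := by
    rw [← sum_add_distrib]
    apply sum_le_sum
    intro x hx
    rw [← sum_add_distrib]
    have hxm : x ∈ P.filter (fun y => pat ρ r y = pat ρ r x) := by simp [hx]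
    have hbpos : 0 < b x := by
      simp only [hb]; exact_mod_cast card_pos.2 ⟨x, hxm⟩
    have : ∀ y ∈ P, (if y ∈ (P.filter (fun y => pat ρ r y = pat ρ r x)).erase x then ε / b x else 0) ≤ (if pat ρ r x = pat ρ r y then D x y / b x else 0) + (if pat ρ r x = pat ρ r y then D y x / b x else 0) := by
      intro y hy
      simp only [mem_erase, mem_filter]
      by_cases h : pat ρ r x = pat ρ r y
      · simp only [h, if_true]
        rw [← add_div, hD]
        by_cases hxy : x = y
        · subst hxy; simp
        · have := hsep x hx y hy hxy
          simp only [ne_eq, Ne.symm hxy, not_false_eq_true, hy, and_self, if_true]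
          gcongr
      · simp [h, Ne.symm h]
    refine le_trans ?_ (sum_le_sum this)
    rw [sum_ite_mem, Finset.inter_eq_right.2 ((erase_subset _ _).trans (filter_subset _ _)), sum_const, nsmul_eq_mul, cast_card_erase_of_mem hxm]
    change _ ≤ (b x - 1) * (ε / b x)
    apply le_of_eq
    field_simp
  have e4 : ∑ x ∈ P, ε * (1 - 1 / b x) = ε * (P.card - (P.image (pat ρ r)).card) := by
    rw [← mul_sum, sum_sub_distrib, sum_inv_class]; simp
  change _ ≤ ∑ t, μ t * ∑ x ∈ P, ∑ y ∈ P, (if pat ρ r x = pat ρ r y ∧ (¬ ρ x t ∧ ρ y t) then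
        (1 : ℝ) / b x else 0)
  rw [e1]
  rw [← e2, e4] at e3
  linarith

lemma packing {V T : Type*} [Fintype T] (s : ℕ) (P : Finset V) (ρ : V → T → Prop)
    (μ : T → ℝ) (hμ : ∀ t, 0 ≤ μ t) (hμ1 : ∑ t, μ t = 1) (ε K : ℝ) (hε : 0 ≤ ε) (d0 : ℕ)
    (hsep : ∀ x ∈ P, ∀ y ∈ P, x ≠ y → ε ≤ ∑ t, if (ρ x t ↔ ρ y t) then 0 else μ t)
    (hK : ∀ r : Fin s → T, ((P.image (pat ρ r)).card : ℝ) ≤ K)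
    (hv : ∀ r : Fin (s+1) → T, ∀ B, (P.image (pat ρ r)).Shatters B → B.card ≤ d0) :
    (s + 1) * (ε / 2 * (P.card - K)) ≤ d0 * P.card := by
  have hone : ∀ k : ℕ, ∑ r : Fin k → T, ∏ i, μ (r i) = 1 := by
    intro k
    have := (Finset.sum_pow' (univ : Finset T) μ k)
    rw [hμ1, one_pow] at this
    rw [this]; simp
  let e : (Fin (s+1) → T) → Fin (s+1) → ℝ := fun R i =>
    ∑ A ∈ univ.filter (fun A : Finset (Fin (s+1)) => i ∉ A),
      ((min (wt P (pat ρ R) A) (wt P (pat ρ R) (insert i A)) : ℕ) : ℝ)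
  have hup : ∑ R : Fin (s+1) → T, (∏ k, μ (R k)) * ∑ i, e R i ≤ d0 * P.card := by
    calc _ ≤ ∑ R : Fin (s+1) → T, (∏ k, μ (R k)) * (d0 * P.card) := by
          apply sum_le_sum
          intro R _
          apply mul_le_mul_of_nonneg_left _ (prod_nonneg (fun k _ => hμ _))
          simp only [e]
          exact_mod_cast layer P (pat ρ R) d0 (hv R)
      _ = _ := by rw [← sum_mul, hone, one_mul]
  have hlow : ∀ i : Fin (s+1), ε / 2 * (P.card - K) ≤ ∑ R : Fin (s+1) → T, (∏ k, μ (R k)) * e R i := by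
    intro i
    rw [← (Fin.insertNthEquiv (fun _ => T) i).sum_comp, Fintype.sum_prod_type, sum_comm]
    calc _ = ∑ r : Fin s → T, (∏ k, μ (r k)) * (ε / 2 * (P.card - K)) := by
          rw [← sum_mul, hone, one_mul]
      _ ≤ _ := by
          apply sum_le_sum
          intro r _
          have : ∀ t, (∏ k, μ ((Fin.insertNthEquiv (fun _ => T) i) (t, r) k)) * e ((Fin.insertNthEquiv (fun _ => T) i) (t, r)) i
              = (∏ k, μ (r k)) * (μ t * e (i.insertNth t r : Fin (s+1) → T) i) := by
            intro t
            rw [Fin.prod_univ_succAbove _ i]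
            simp [Fin.insertNthEquiv]
            ring
          rw [sum_congr rfl (fun t _ => this t), ← mul_sum]
          apply mul_le_mul_of_nonneg_left _ (prod_nonneg (fun k _ => hμ _))
          calc ε / 2 * (P.card - K) ≤ ε / 2 * (P.card - (P.image (pat ρ r)).card) := by
                have := hK r
                gcongr
            _ ≤ _ := avg_lower P ρ r μ ε hsep
            _ ≤ _ := by
                apply sum_le_sum
                intro t _
                exact mul_le_mul_of_nonneg_left (edge_lower P ρ r t i) (hμ t)
  calc ((s : ℝ) + 1) * (ε / 2 * (P.card - K)) = ∑ i : Fin (s+1), (ε / 2 * (P.card - K)) := by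
        simp
    _ ≤ ∑ i : Fin (s+1), ∑ R : Fin (s+1) → T, (∏ k, μ (R k)) * e R i := sum_le_sum (fun i _ => hlow i)
    _ = _ := by rw [sum_comm]; simp only [mul_sum]
    _ ≤ _ := hup

lemma exists_d0 (c d : ℝ) : ∃ d0 : ℕ, 1 ≤ d0 ∧ ∀ I : ℕ, (2:ℝ) ^ I ≤ c * (I:ℝ) ^ d → I ≤ d0 := by
  have h := (isLittleO_rpow_exp_pos_mul_atTop d (b := Real.log 2) (Real.log_pos (by norm_num)))
  have h2 := (h.def (c := 1 / (2 * (|c| + 1))) (by positivity))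
  rw [Filter.eventually_atTop] at h2
  obtain ⟨a, ha⟩ := h2
  refine ⟨⌈a⌉₊ + 1, by omega, ?_⟩
  intro I hI
  by_contra hlt
  push Not at hlt
  have : a ≤ I := (Nat.le_ceil a).trans (by exact_mod_cast (by omega : ⌈a⌉₊ ≤ I))
  have h3 := ha I this
  have e : Real.exp (Real.log 2 * I) = 2 ^ I := by
    rw [mul_comm, Real.exp_nat_mul, Real.exp_log (by norm_num)]
  rw [e, Real.norm_of_nonneg (by positivity), Real.norm_of_nonneg (by positivity)] at h3
  have hp : (0:ℝ) < 2 ^ I := by positivity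
  have h4 : c * (I:ℝ)^d ≤ (|c| + 1) * (1 / (2 * (|c| + 1)) * 2 ^ I) := by
    apply mul_le_mul _ h3 (by positivity) (by positivity)
    linarith [le_abs_self c]
  have h5 : (|c| + 1) * (1 / (2 * (|c| + 1)) * 2 ^ I) = 2 ^ I / 2 := by
    have : |c| + 1 ≠ 0 := by positivity
    field_simp
  linarith

noncomputable def dis {V : Type*} [DecidableEq V] (𝒮 : Finset (Finset V)) (w : Finset V → ℝ) (x y : V) : ℝ :=
  ∑ S ∈ 𝒮, if (x ∈ S ↔ y ∈ S) then 0 else w S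

lemma dis_triangle {V : Type*} [DecidableEq V] (𝒮 : Finset (Finset V)) (w : Finset V → ℝ) (hw : ∀ S ∈ 𝒮, 0 ≤ w S)
    (x y z : V) : dis 𝒮 w x y ≤ dis 𝒮 w x z + dis 𝒮 w y z := by
  unfold dis
  rw [← sum_add_distrib]
  apply sum_le_sum
  intro S hS
  have := hw S hS
  by_cases h1 : x ∈ S <;> by_cases h2 : y ∈ S <;> by_cases h3 : z ∈ S <;> simp [h1, h2, h3, this]

lemma pack_card {V : Type*} [DecidableEq V] (c d : ℝ) (hc : 0 < c) (hd : 1 ≤ d) (d0 : ℕ) (hd0 : 1 ≤ d0)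
    (hI : ∀ I : ℕ, (2:ℝ) ^ I ≤ c * (I:ℝ) ^ d → I ≤ d0)
    (X : Finset V) (𝒮 : Finset (Finset V))
    (hS : ∀ R ⊆ 𝒮, R.Nonempty →
        ((X.image fun x => R.filter fun r => x ∈ r).card : ℝ) ≤ c * (R.card : ℝ) ^ d)
    (w : Finset V → ℝ) (hw : ∀ S ∈ 𝒮, 0 ≤ w S) (hW : 0 < ∑ S ∈ 𝒮, w S) (s : ℕ) (hs : 1 ≤ s)
    (P : Finset V) (hP : P ⊆ X)
    (hsep : ∀ x ∈ P, ∀ y ∈ P, x ≠ y → 4 * d0 / (s + 1) * ∑ S ∈ 𝒮, w S ≤ dis 𝒮 w x y) :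
    (P.card : ℝ) ≤ 2 * (c * (s:ℝ) ^ d) := by
  set W := ∑ S ∈ 𝒮, w S with hWdef
  have hsum : ∀ f : Finset V → ℝ, ∑ t : {S // S ∈ 𝒮}, f t.1 = ∑ S ∈ 𝒮, f S := by
    intro f; exact Finset.sum_coe_sort 𝒮 f
  have key := packing (T := {S // S ∈ 𝒮}) s P (fun x t => x ∈ t.1) (fun t => w t.1 / W)
    (fun t => div_nonneg (hw _ t.2) hW.le)
    (by rw [hsum (fun S => w S / W), ← sum_div]; exact div_self hW.ne')
    (4 * d0 / (s + 1)) (c * (s:ℝ)^d) (by positivity) d0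
    (by
      intro x hx y hy hxy
      have h := hsep x hx y hy hxy
      rw [← le_div_iff₀ hW, dis, sum_div, ← Finset.sum_coe_sort] at h
      refine h.trans (le_of_eq (sum_congr rfl (fun S _ => ?_)))
      by_cases h1 : x ∈ S.1 <;> by_cases h2 : y ∈ S.1 <;> simp [h1, h2])
    (by
      intro r
      set R : Finset (Finset V) := univ.image (fun i => (r i).1) with hR
      have hR1 : R ⊆ 𝒮 := by
        intro S hS'
        obtain ⟨i, _, rfl⟩ := mem_image.1 hS'
        exact (r i).2
      have hR2 : R.Nonempty := ⟨(r ⟨0, hs⟩).1, mem_image_of_mem _ (mem_univ _)⟩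
      have hR3 : R.card ≤ s := by
        refine card_image_le.trans ?_
        simp
      have h1 := hS R hR1 hR2
      have h2 : P.image (pat (fun (x : V) (t : {S // S ∈ 𝒮}) => x ∈ t.1) r) ⊆
          (X.image fun x => R.filter fun r => x ∈ r).image (fun tr => univ.filter (fun i => (r i).1 ∈ tr)) := by
        intro A hA
        obtain ⟨x, hx, rfl⟩ := mem_image.1 hA
        rw [mem_image]
        refine ⟨R.filter fun r => x ∈ r, mem_image_of_mem _ (hP hx), ?_⟩
        ext i
        simp [pat, hR]
      have h3 := (card_le_card h2).trans card_image_le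
      calc _ ≤ ((X.image fun x => R.filter fun r => x ∈ r).card : ℝ) := by exact_mod_cast h3
        _ ≤ _ := h1
        _ ≤ _ := by
          gcongr)
    (by
      intro r B hB
      rcases B.eq_empty_or_nonempty with rfl | hne
      · simp
      set R : Finset (Finset V) := B.image (fun i => (r i).1) with hR
      have hR1 : R ⊆ 𝒮 := by
        intro S hS'
        obtain ⟨i, _, rfl⟩ := mem_image.1 hS'
        exact (r i).2
      have h1 := hS R hR1 (hne.image _)
      have hinj : Set.InjOn (fun i => (r i).1) (B : Set (Fin (s+1))) := by
        intro i hi j hj hij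
        by_contra hne
        obtain ⟨u, hu, he⟩ := hB (t := {i}) (by simpa using hi)
        obtain ⟨x, hx, rfl⟩ := mem_image.1 hu
        have hi' : i ∈ B ∩ pat (fun (x : V) (t : {S // S ∈ 𝒮}) => x ∈ t.1) r x := by rw [he]; simp
        have hj' : j ∉ B ∩ pat (fun (x : V) (t : {S // S ∈ 𝒮}) => x ∈ t.1) r x := by rw [he]; simp [Ne.symm hne]
        simp only [pat, mem_inter, mem_filter, mem_univ, true_and, not_and] at hi' hj'
        apply hj' hj
        dsimp only at hij
        rw [← hij]; exact hi'.2
      have hRc : R.card = B.card := card_image_of_injOn hinj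
      apply hI
      rw [hRc] at h1
      refine le_trans ?_ h1
      have h2 : B.powerset ⊆
          (X.image fun x => R.filter fun r => x ∈ r).image (fun tr => B.filter (fun i => (r i).1 ∈ tr)) := by
        intro t ht
        obtain ⟨u, hu, he⟩ := hB (mem_powerset.1 ht)
        obtain ⟨x, hx, rfl⟩ := mem_image.1 hu
        rw [mem_image]
        refine ⟨R.filter fun r => x ∈ r, mem_image_of_mem _ (hP hx), ?_⟩
        rw [← he]
        ext i
        simp only [mem_filter, mem_inter, pat, mem_univ, true_and, hR]
        constructor
        · tauto
        · intro h; exact ⟨h.1, mem_image_of_mem _ h.1, h.2⟩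
      have h3 := (card_le_card h2).trans card_image_le
      rw [card_powerset] at h3
      exact_mod_cast h3)
  have hs1 : (0:ℝ) < s + 1 := by positivity
  have : ((s:ℝ) + 1) * (4 * d0 / (s + 1) / 2 * (P.card - c * (s:ℝ)^d)) = 2 * d0 * (P.card - c * (s:ℝ)^d) := by
    field_simp; ring
  rw [this] at key
  have hd0' : (0:ℝ) < d0 := by exact_mod_cast hd0
  have : (d0:ℝ) * (P.card) ≤ d0 * (2 * (c * (s:ℝ)^d)) := by linarith
  exact le_of_mul_le_mul_left this hd0'

lemma color {V : Type*} [DecidableEq V] (c d : ℝ) (hc : 0 < c) (hd : 1 ≤ d) (d0 : ℕ) (hd0 : 1 ≤ d0)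
    (hI : ∀ I : ℕ, (2:ℝ) ^ I ≤ c * (I:ℝ) ^ d → I ≤ d0)
    (X : Finset V) (𝒮 : Finset (Finset V))
    (hS : ∀ R ⊆ 𝒮, R.Nonempty →
        ((X.image fun x => R.filter fun r => x ∈ r).card : ℝ) ≤ c * (R.card : ℝ) ^ d)
    (w : Finset V → ℝ) (hw : ∀ S ∈ 𝒮, 0 ≤ w S) (hW : 0 < ∑ S ∈ 𝒮, w S) (s : ℕ) (hs : 1 ≤ s)
    (Y : Finset V) (hY : Y ⊆ X) :
    ∃ P ⊆ Y, ∃ f : V → V, (∀ x ∈ Y, f x ∈ P) ∧ (P.card : ℝ) ≤ 2 * (c * (s:ℝ) ^ d) ∧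
      ∀ x ∈ Y, ∀ y ∈ Y, f x = f y → dis 𝒮 w x y ≤ 2 * (4 * d0 / (s + 1) * ∑ S ∈ 𝒮, w S) := by
  set η := 4 * d0 / (s + 1) * ∑ S ∈ 𝒮, w S with hη
  have hη0 : 0 ≤ η := by positivity
  let sep : Finset V → Prop := fun P => ∀ x ∈ P, ∀ y ∈ P, x ≠ y → η ≤ dis 𝒮 w x y
  obtain ⟨P, hP, hmax⟩ := Finset.exists_max_image (Y.powerset.filter sep) (fun P => P.card)
    ⟨∅, by simp [sep]⟩
  rw [mem_filter, mem_powerset] at hP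
  have hcomm : ∀ x y, dis 𝒮 w x y = dis 𝒮 w y x := by
    intro x y; unfold dis; apply sum_congr rfl; intro S _; by_cases h1 : x ∈ S <;> by_cases h2 : y ∈ S <;> simp [h1, h2]
  have hself : ∀ x, dis 𝒮 w x x = 0 := by intro x; simp [dis]
  have hcov : ∀ x ∈ Y, ∃ p ∈ P, dis 𝒮 w x p ≤ η := by
    intro x hx
    by_contra hcon
    push Not at hcon
    have hxP : x ∉ P := fun h => by have := hcon x h; rw [hself] at this; linarith
    have := hmax (insert x P) (by
      rw [mem_filter, mem_powerset]
      refine ⟨insert_subset hx hP.1, ?_⟩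
      intro a ha b hb hab
      rw [mem_insert] at ha hb
      rcases ha with rfl | ha <;> rcases hb with rfl | hb
      · exact absurd rfl hab
      · exact (hcon b hb).le
      · rw [hcomm]; exact (hcon a ha).le
      · exact hP.2 a ha b hb hab)
    rw [card_insert_of_notMem hxP] at this
    omega
  choose! f hf using hcov
  refine ⟨P, hP.1, f, fun x hx => (hf x hx).1, ?_, ?_⟩
  · exact pack_card c d hc hd d0 hd0 hI X 𝒮 hS w hw hW s hs P (hP.1.trans hY) hP.2
  · intro x hx y hy hxy
    have h1 := (hf x hx).2
    have h2 := (hf y hy).2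
    rw [← hxy] at h2
    have := dis_triangle 𝒮 w hw x y (f x)
    linarith

lemma matching_card {V : Type*} [DecidableEq V] (M : Finset (Finset V))
    (hMd : (M : Set (Finset V)).PairwiseDisjoint id) (h2 : ∀ e ∈ M, e.card = 2) :
    (M.biUnion id).card = 2 * M.card := by
  rw [card_biUnion (fun a ha b hb hab => hMd ha hb hab)]
  rw [mul_comm]
  exact Finset.sum_const_nat h2

lemma greedy {V : Type*} [DecidableEq V] (c d : ℝ) (hc : 0 < c) (hd : 1 ≤ d) (d0 : ℕ) (hd0 : 1 ≤ d0)
    (hI : ∀ I : ℕ, (2:ℝ) ^ I ≤ c * (I:ℝ) ^ d → I ≤ d0)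
    (X : Finset V) (𝒮 : Finset (Finset V))
    (hS : ∀ R ⊆ 𝒮, R.Nonempty →
        ((X.image fun x => R.filter fun r => x ∈ r).card : ℝ) ≤ c * (R.card : ℝ) ^ d)
    (hne : 𝒮.Nonempty)
    (s : ℕ) (hs : 1 ≤ s) (m : ℝ) (hm : 2 * (c * (s:ℝ) ^ d) ≤ m)
    (F : Finset (Finset V)) (hF : F ⊆ X.powersetCard 2)
    (hgood : ∀ Y ⊆ X, X.card ≤ 2 * Y.card → ∀ P ⊆ Y, ∀ f : V → V, (∀ x ∈ Y, f x ∈ P) →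
      (P.card : ℝ) ≤ m → ∃ x ∈ Y, ∃ y ∈ Y, x ≠ y ∧ f x = f y ∧ {x, y} ∈ F) :
    ∀ i ≤ X.card / 4, ∃ M ⊆ F, M.card = i ∧ (M : Set (Finset V)).PairwiseDisjoint id ∧
      ∑ S ∈ 𝒮, (2:ℝ) ^ (M.filter fun e => (S ∩ e).card = 1).card
        ≤ 𝒮.card * (1 + 2 * (4 * d0 / (s + 1))) ^ i := by
  intro i
  induction i with
  | zero =>
    intro _
    exact ⟨∅, by simp, by simp, by simp, by simp⟩
  | succ i ih =>
    intro hi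
    obtain ⟨M, hMF, hMc, hMd, hMw⟩ := ih (by omega)
    set w : Finset V → ℝ := fun S => (2:ℝ) ^ (M.filter fun e => (S ∩ e).card = 1).card with hw
    have hwp : ∀ S, 0 < w S := fun S => by simp only [hw]; positivity
    have hW : 0 < ∑ S ∈ 𝒮, w S := sum_pos (fun S _ => hwp S) hne
    set Y := X \ M.biUnion id with hYdef
    have hY : Y ⊆ X := sdiff_subset
    have hMX : ∀ e ∈ M, e ⊆ X ∧ e.card = 2 := fun e he => mem_powersetCard.1 (hF (hMF he))
    have hU : (M.biUnion id).card = 2 * i := by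
      rw [matching_card M hMd (fun e he => (hMX e he).2), hMc]
    have hUX : M.biUnion id ⊆ X := by
      intro x hx
      obtain ⟨e, he, hxe⟩ := mem_biUnion.1 hx
      exact (hMX e he).1 hxe
    have hYc : Y.card = X.card - 2 * i := by rw [hYdef, card_sdiff_of_subset hUX, hU]
    obtain ⟨P, hPY, f, hfP, hPc, hfd⟩ := color c d hc hd d0 hd0 hI X 𝒮 hS w (fun S _ => (hwp S).le) hW s hs Y hY
    obtain ⟨x, hx, y, hy, hxy, hfxy, hxyF⟩ := hgood Y hY (by omega) P hPY f hfP (hPc.trans hm)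
    have hdis := hfd x hx y hy hfxy
    have hxM : ∀ e ∈ M, x ∉ e := by
      intro e he hxe
      exact (mem_sdiff.1 hx).2 (mem_biUnion.2 ⟨e, he, hxe⟩)
    have hyM : ∀ e ∈ M, y ∉ e := by
      intro e he hxe
      exact (mem_sdiff.1 hy).2 (mem_biUnion.2 ⟨e, he, hxe⟩)
    have hnot : ({x, y} : Finset V) ∉ M := fun h => hxM _ h (by simp)
    refine ⟨insert {x, y} M, insert_subset hxyF hMF, by rw [card_insert_of_notMem hnot, hMc], ?_, ?_⟩
    · rw [coe_insert]
      apply hMd.insert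
      intro e he _
      rw [id, id, Finset.disjoint_left]
      intro z hz
      simp only [mem_insert, mem_singleton] at hz
      rcases hz with rfl | rfl
      · exact hxM e he
      · exact hyM e he
    · have hcr : ∀ S : Finset V, (S ∩ {x, y}).card = 1 ↔ ¬ (x ∈ S ↔ y ∈ S) := by
        intro S
        by_cases h1 : x ∈ S <;> by_cases h2 : y ∈ S
        · have : S ∩ {x, y} = {x, y} := by
            rw [inter_eq_right]; intro z; simp only [mem_insert, mem_singleton]; rintro (rfl | rfl) <;> assumption
          rw [this, card_pair hxy]; simp [h1, h2]
        · have : S ∩ {x, y} = {x} := by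
            ext z; simp only [mem_inter, mem_insert, mem_singleton]
            constructor
            · rintro ⟨h, rfl | rfl⟩
              · rfl
              · exact absurd h h2
            · rintro rfl; exact ⟨h1, Or.inl rfl⟩
          rw [this]; simp [h1, h2]
        · have : S ∩ {x, y} = {y} := by
            ext z; simp only [mem_inter, mem_insert, mem_singleton]
            constructor
            · rintro ⟨h, rfl | rfl⟩
              · exact absurd h h1
              · rfl
            · rintro rfl; exact ⟨h2, Or.inr rfl⟩
          rw [this]; simp [h1, h2]
        · have : S ∩ {x, y} = ∅ := by
            ext z; simp only [mem_inter, mem_insert, mem_singleton, notMem_empty, iff_false]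
            rintro ⟨h, rfl | rfl⟩
            · exact h1 h
            · exact h2 h
          rw [this]; simp [h1, h2]
      have hstep : ∀ S ∈ 𝒮, (2:ℝ) ^ ((insert {x, y} M).filter fun e => (S ∩ e).card = 1).card
          = w S + if (x ∈ S ↔ y ∈ S) then 0 else w S := by
        intro S _
        rw [filter_insert]
        by_cases h : (x ∈ S ↔ y ∈ S)
        · rw [if_neg (by rw [hcr]; exact not_not.2 h), if_pos h]; simp [hw]
        · rw [if_pos ((hcr S).2 h), if_neg h, card_insert_of_notMem (by simp [hnot])]
          simp only [hw]; rw [pow_succ]; ring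
      rw [sum_congr rfl hstep, sum_add_distrib]
      change _ + dis 𝒮 w x y ≤ _
      rw [pow_succ]
      have hnn : (0:ℝ) ≤ 1 + 2 * (4 * d0 / (s + 1)) := by positivity
      calc _ ≤ (∑ S ∈ 𝒮, w S) * (1 + 2 * (4 * d0 / (s + 1))) := by linarith
        _ ≤ (𝒮.card * (1 + 2 * (4 * d0 / (s + 1))) ^ i) * (1 + 2 * (4 * d0 / (s + 1))) := by gcongr
        _ = _ := by ring

lemma greedy_final {V : Type*} [DecidableEq V] (𝒮 M : Finset (Finset V)) (i : ℕ) (ε : ℝ) (hε : 0 ≤ ε)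
    (h : ∑ S ∈ 𝒮, (2:ℝ) ^ (M.filter fun e => (S ∩ e).card = 1).card ≤ 𝒮.card * (1 + ε) ^ i)
    (S : Finset V) (hS : S ∈ 𝒮) :
    ((M.filter fun e => (S ∩ e).card = 1).card : ℝ) ≤ 2 * (ε * i + Real.log 𝒮.card) := by
  set κ := (M.filter fun e => (S ∩ e).card = 1).card
  have h1 : (2:ℝ) ^ κ ≤ 𝒮.card * (1 + ε) ^ i :=
    (Finset.single_le_sum (f := fun S => (2:ℝ) ^ (M.filter fun e => (S ∩ e).card = 1).card)
      (fun S _ => by positivity) hS).trans h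
  have hc : (0:ℝ) < 𝒮.card := by exact_mod_cast card_pos.2 ⟨S, hS⟩
  have hc1 : (1:ℝ) ≤ 𝒮.card := by exact_mod_cast card_pos.2 ⟨S, hS⟩
  have h2 := Real.log_le_log (by positivity) h1
  rw [Real.log_mul hc.ne' (by positivity), Real.log_pow, Real.log_pow] at h2
  have h3 : Real.log (1 + ε) ≤ ε := by
    have := Real.log_le_sub_one_of_pos (show 0 < 1 + ε by linarith); linarith
  have h4 : (i:ℝ) * Real.log (1 + ε) ≤ i * ε := by gcongr
  have h5 : (1/2:ℝ) ≤ Real.log 2 := by have := Real.log_two_gt_d9; linarith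
  have h6 : (κ:ℝ) * (1/2) ≤ κ * Real.log 2 := by gcongr
  linarith

lemma qpow (p' N : ℝ) (a : ℕ) (hp : 0 ≤ p') (ha : 1 ≤ a) (hN : N ≤ a) :
    (1 - min p' 1) ^ a ≤ Real.exp (-(p' * N)) := by
  rcases le_total 1 p' with h | h
  · rw [min_eq_right h, sub_self, zero_pow (by omega)]; positivity
  · rw [min_eq_left h]
    calc (1 - p') ^ a ≤ (Real.exp (-p')) ^ a := by
          apply pow_le_pow_left₀ (by linarith)
          have := Real.add_one_le_exp (-p'); linarith
      _ = Real.exp (-(p' * a)) := by rw [← Real.exp_nat_mul]; ring_nf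
      _ ≤ _ := by
          apply Real.exp_le_exp.2
          have := mul_le_mul_of_nonneg_left hN hp
          linarith

noncomputable def monoSet {V : Type*} [DecidableEq V] (X Y : Finset V) (f : V → V) : Finset (Finset V) :=
  X.biUnion (fun c => (Y.filter (fun x => f x = c)).powersetCard 2)

lemma mono_card {V : Type*} [DecidableEq V] (X Y P : Finset V) (f : V → V) (hP : P ⊆ X)
    (hf : ∀ x ∈ Y, f x ∈ P) :
    (Y.card : ℝ) ^ 2 ≤ P.card * (2 * (monoSet X Y f).card + Y.card) := by
  have hYP : Y.card = ∑ c ∈ P, (Y.filter (fun x => f x = c)).card :=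
    Finset.card_eq_sum_card_fiberwise hf
  have hm : ∑ c ∈ P, ((Y.filter (fun x => f x = c)).card.choose 2) ≤ (monoSet X Y f).card := by
    have : P.biUnion (fun c => (Y.filter (fun x => f x = c)).powersetCard 2) ⊆ monoSet X Y f :=
      biUnion_subset_biUnion_of_subset_left _ hP
    refine le_trans (le_of_eq ?_) (card_le_card this)
    rw [card_biUnion]
    · simp only [card_powersetCard]
    · intro a _ b _ hab
      change Disjoint _ _
      rw [Finset.disjoint_left]
      intro e he he'
      rw [mem_powersetCard] at he he'
      have : e.Nonempty := card_pos.1 (by omega)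
      obtain ⟨x, hx⟩ := this
      have h1 := (mem_filter.1 (he.1 hx)).2
      have h2 := (mem_filter.1 (he'.1 hx)).2
      exact hab (h1.symm.trans h2)
  have hsq : ∑ c ∈ P, ((Y.filter (fun x => f x = c)).card : ℝ) ^ 2 ≤ 2 * (monoSet X Y f).card + Y.card := by
    have hm' : ∑ c ∈ P, (((Y.filter (fun x => f x = c)).card.choose 2 : ℕ) : ℝ) ≤ (monoSet X Y f).card := by exact_mod_cast hm
    have : ∀ c ∈ P, ((Y.filter (fun x => f x = c)).card : ℝ) ^ 2 = 2 * (((Y.filter (fun x => f x = c)).card.choose 2 : ℕ) : ℝ) + (Y.filter (fun x => f x = c)).card := by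
      intro c _
      rw [Nat.cast_choose_two]; ring
    rw [sum_congr rfl this, sum_add_distrib, ← mul_sum]
    have h3 : (Y.card : ℝ) = ∑ c ∈ P, ((Y.filter (fun x => f x = c)).card : ℝ) := by exact_mod_cast hYP
    linarith
  have hcs := sq_sum_le_card_mul_sum_sq (s := P) (f := fun c => ((Y.filter (fun x => f x = c)).card : ℝ))
  have h3 : (Y.card : ℝ) = ∑ c ∈ P, ((Y.filter (fun x => f x = c)).card : ℝ) := by exact_mod_cast hYP
  rw [← h3] at hcs
  calc _ ≤ _ := hcs
    _ ≤ _ := by gcongr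

/-- deterministic part: many monochromatic pairs -/
lemma mono_many {V : Type*} [DecidableEq V] (X Y P : Finset V) (f : V → V) (hP : P ⊆ X)
    (hf : ∀ x ∈ Y, f x ∈ P) (h2 : 2 ≤ X.card) (hY : X.card ≤ 2 * Y.card) (α : ℝ) (hα : α ≤ 1)
    (hPc : (P.card : ℝ) ≤ (X.card : ℝ) ^ α / 16) :
    (X.card : ℝ) ^ (2 - α) ≤ (monoSet X Y f).card := by
  have h := mono_card X Y P f hP hf
  set n : ℝ := (X.card : ℝ) with hn
  have hn2 : (2:ℝ) ≤ n := by rw [hn]; exact_mod_cast h2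
  have hn0 : 0 < n := by linarith
  set y : ℝ := (Y.card : ℝ) with hyd
  have hy : n ≤ 2 * y := by rw [hn, hyd]; exact_mod_cast hY
  set A : ℝ := n ^ α with hA
  have hA0 : 0 < A := Real.rpow_pos_of_pos hn0 _
  have hAn : A ≤ n := by
    calc A ≤ n ^ (1:ℝ) := Real.rpow_le_rpow_of_exponent_le (by linarith) hα
      _ = n := Real.rpow_one n
  set m : ℝ := ((monoSet X Y f).card : ℝ)
  have hm0 : 0 ≤ m := by positivity
  have hB : n ^ (2 - α) = n ^ 2 / A := by
    rw [Real.rpow_sub hn0, hA]; norm_num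
  rw [hB, div_le_iff₀ hA0]
  have h1 : y ^ 2 ≤ A / 16 * (2 * m + y) := by
    refine h.trans ?_
    gcongr
  nlinarith

lemma color_prob {V : Type*} [DecidableEq V] (X : Finset V) (h2 : 2 ≤ X.card) (α δ : ℝ)
    (hα : α ≤ 1) (hδ0 : 0 < δ) (hδ : δ < 1) (good : Finset (Finset V) → Prop)
    (hgood : ∀ F ⊆ X.powersetCard 2,
      (∀ Y ⊆ X, X.card ≤ 2 * Y.card → ∀ P ⊆ Y, ∀ f : V → V, (∀ x ∈ Y, f x ∈ P) →
      (P.card : ℝ) ≤ (X.card : ℝ) ^ α / 16 → ∃ x ∈ Y, ∃ y ∈ Y, x ≠ y ∧ f x = f y ∧ {x, y} ∈ F) →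
      good F) :
    1 - δ ≤ ∑ F ∈ (X.powersetCard 2).powerset,
        (if good F then (pEdge X.card α δ) ^ F.card
            * (1 - pEdge X.card α δ) ^ ((X.powersetCard 2).card - F.card) else 0) := by
  set n := X.card with hn
  have hn2 : (2:ℝ) ≤ n := by exact_mod_cast h2
  have hn0 : (0:ℝ) < n := by linarith
  have hlogn : 0 ≤ Real.log n := Real.log_nonneg (by linarith)
  have hlogd : 0 ≤ Real.log (2 / δ) := Real.log_nonneg (by rw [le_div_iff₀ hδ0]; linarith)
  set p' := 2 * Real.log n / (n : ℝ) ^ (1 - α) + 4 * Real.log (2 / δ) / (n : ℝ) ^ (2 - α) with hp'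
  have hp'0 : 0 ≤ p' := by positivity
  have hpE : pEdge n α δ = min p' 1 := rfl
  rw [hpE]
  let ex : ({x // x ∈ X} → {x // x ∈ X}) → V → V := fun g x => if h : x ∈ X then (g ⟨x, h⟩).1 else x
  let A : Finset V × ({x // x ∈ X} → {x // x ∈ X}) → Finset (Finset V) := fun a => monoSet X a.1 (ex a.2)
  let I := (X.powerset ×ˢ (univ : Finset ({x // x ∈ X} → {x // x ∈ X}))).filter
    (fun a => (n : ℝ) ^ (2 - α) ≤ (A a).card)
  have hub := union_bound (X.powersetCard 2) (min p' 1) (le_min hp'0 zero_le_one) (min_le_right _ _)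
    good I A ?_ ?_
  · refine le_trans ?_ hub
    have hterm : ∀ a ∈ I, (1 - min p' 1) ^ (A a).card ≤ ((n:ℝ) ^ (2 * n))⁻¹ * (δ / 2) ^ 4 := by
      intro a ha
      have hN := (mem_filter.1 ha).2
      have hpos : (0:ℝ) < (n : ℝ) ^ (2 - α) := by positivity
      have h1 : 1 ≤ (A a).card := by
        have : (0:ℝ) < (A a).card := hpos.trans_le hN
        exact_mod_cast this
      refine (qpow p' _ _ hp'0 h1 hN).trans (le_of_eq ?_)
      have e1 : (n : ℝ) ^ (2 - α) = n * (n:ℝ) ^ (1 - α) := by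
        rw [show 2 - α = 1 + (1 - α) by ring, Real.rpow_add hn0, Real.rpow_one]
      have e2 : p' * (n : ℝ) ^ (2 - α) = (2 * n : ℕ) * Real.log n + (4:ℕ) * Real.log (2 / δ) := by
        rw [hp', add_mul, div_mul_cancel₀ _ hpos.ne', e1]
        have : (n:ℝ) ^ (1 - α) ≠ 0 := by positivity
        push_cast
        field_simp
      rw [e2, Real.exp_neg, Real.exp_add, Real.exp_nat_mul, Real.exp_nat_mul, Real.exp_log hn0,
        Real.exp_log (by positivity), mul_inv, ← inv_pow (2 / δ), inv_div]
    have hcard : (I.card : ℝ) ≤ (n:ℝ) ^ (2 * n) := by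
      have h1 : I.card ≤ 2 ^ n * n ^ n := by
        refine (card_filter_le _ _).trans ?_
        rw [card_product, card_powerset]
        simp [hn]
      have h3 : 2 ^ n * n ^ n ≤ n ^ (2 * n) := by
        rw [two_mul, pow_add]
        exact Nat.mul_le_mul_right _ (Nat.pow_le_pow_left h2 n)
      exact_mod_cast h1.trans h3
    have hs := sum_le_card_nsmul I _ _ hterm
    rw [nsmul_eq_mul] at hs
    have hpos : (0:ℝ) < (n:ℝ) ^ (2 * n) := by positivity
    have : (I.card : ℝ) * (((n:ℝ) ^ (2 * n))⁻¹ * (δ / 2) ^ 4) ≤ (n:ℝ) ^ (2 * n) * (((n:ℝ) ^ (2 * n))⁻¹ * (δ / 2) ^ 4) := by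
      gcongr
    rw [mul_inv_cancel_left₀ hpos.ne'] at this
    have h4 : (δ / 2) ^ 4 ≤ δ := by
      have : (δ/2)^4 ≤ (δ/2)^1 := pow_le_pow_of_le_one (by linarith) (by linarith) (by norm_num)
      linarith
    linarith
  · intro a ha
    have hY := mem_powerset.1 (mem_product.1 (mem_filter.1 ha).1).1
    intro e he
    obtain ⟨c, _, he⟩ := mem_biUnion.1 he
    rw [mem_powersetCard] at he ⊢
    exact ⟨he.1.trans ((filter_subset _ _).trans hY), he.2⟩
  · intro F hF hng
    by_contra hcon
    push Not at hcon
    apply hng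
    apply hgood F hF
    intro Y hY hYc P hP f hf hPc
    by_contra hno
    push Not at hno
    let g : {x // x ∈ X} → {x // x ∈ X} := fun x => if h : f x.1 ∈ X then ⟨f x.1, h⟩ else x
    have hex : ∀ x ∈ Y, ex g x = f x := by
      intro x hx
      simp [ex, g, hY hx, (hP.trans hY) (hf x hx)]
    apply hcon (Y, g)
    · rw [mem_filter, mem_product]
      refine ⟨⟨mem_powerset.2 hY, mem_univ _⟩, ?_⟩
      exact mono_many X Y P (ex g) (hP.trans hY) (fun x hx => by rw [hex x hx]; exact hf x hx) h2 hYc α hα hPc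
    · rw [Finset.disjoint_left]
      intro e heF he
      obtain ⟨c, _, he⟩ := mem_biUnion.1 he
      rw [mem_powersetCard] at he
      obtain ⟨x, y, hxy, rfl⟩ := card_eq_two.1 he.2
      have hx := mem_filter.1 (he.1 (show x ∈ ({x, y} : Finset V) by simp))
      have hy := mem_filter.1 (he.1 (show y ∈ ({x, y} : Finset V) by simp))
      exact hno x hx.1 y hy.1 hxy (by rw [← hex x hx.1, ← hex y hy.1, hx.2]; exact hy.2.symm) heF

lemma aug {V : Type*} [DecidableEq V] (M : Finset (Finset V)) (hMd : (M : Set (Finset V)).PairwiseDisjoint id)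
    (e : Finset V) (hne : e.Nonempty) (h : ∀ e' ∈ M, Disjoint e e') :
    ((insert e M : Finset (Finset V)) : Set (Finset V)).PairwiseDisjoint id ∧ (insert e M).card = M.card + 1 := by
  constructor
  · rw [coe_insert]
    apply hMd.insert
    intro e' he' _
    exact h e' he'
  · apply card_insert_of_notMem
    intro he
    have := h e he
    rw [disjoint_self] at this
    exact hne.ne_empty this

noncomputable def unc {V : Type*} [DecidableEq V] (X : Finset V) (B : Finset (V × V)) (T : Finset (V × V × V)) :
    Finset V := X \ (B.biUnion (fun b => {b.1, b.2}) ∪ T.biUnion (fun t => {t.1, t.2.1}))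

noncomputable def miss {V : Type*} [DecidableEq V] (X : Finset V) (B : Finset (V × V)) (T : Finset (V × V × V)) :
    Finset (Finset V) :=
  (unc X B T).powersetCard 2 ∪
    (B.biUnion (fun b => (unc X B T).image (fun x => {b.1, x})) ∪
     T.biUnion (fun t => ((unc X B T).erase t.2.2).image (fun x => {t.1, x}) ∪
        ((unc X B T).erase t.2.2).image (fun x => {t.2.1, x})))

lemma pair_inj {V : Type*} [DecidableEq V] {u v x y : V} (h : ({u, x} : Finset V) = {v, y}) (hu : u ≠ y) :
    u = v := by
  have : u ∈ ({v, y} : Finset V) := by rw [← h]; simp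
  simp only [mem_insert, mem_singleton] at this
  exact this.resolve_right hu

lemma image_pair_card {V : Type*} [DecidableEq V] (U : Finset V) (u : V) (hu : u ∉ U) :
    (U.image (fun x => ({u, x} : Finset V))).card = U.card := by
  apply card_image_of_injOn
  intro x hx y hy hxy
  dsimp only at hxy
  rw [Finset.pair_comm, Finset.pair_comm u y] at hxy
  exact pair_inj hxy (fun h => hu (h ▸ hx))

lemma structure_lem {V : Type*} [DecidableEq V] [Nonempty V] (X : Finset V) (F : Finset (Finset V))
    (hF : F ⊆ X.powersetCard 2) (M : Finset (Finset V)) (hMF : M ⊆ F)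
    (hMd : (M : Set (Finset V)).PairwiseDisjoint id)
    (hmax : ∀ M' ⊆ F, (M' : Set (Finset V)).PairwiseDisjoint id → M'.card ≤ M.card) :
    ∃ (B : Finset (V × V)) (T : Finset (V × V × V)), B ⊆ X ×ˢ X ∧ T ⊆ X ×ˢ (X ×ˢ X) ∧
      B.card + T.card = M.card ∧ Disjoint F (miss X B T) ∧ miss X B T ⊆ X.powersetCard 2 ∧
      (miss X B T).card = (X.card - 2 * M.card).choose 2 + B.card * (X.card - 2 * M.card)
        + T.card * (2 * (X.card - 2 * M.card - 1)) := by
  have hMX : ∀ e ∈ M, e ⊆ X ∧ e.card = 2 := fun e he => mem_powersetCard.1 (hF (hMF he))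
  set U := X \ M.biUnion id with hUdef
  have hUX : M.biUnion id ⊆ X := by
    intro x hx
    obtain ⟨e, he, hxe⟩ := mem_biUnion.1 hx
    exact (hMX e he).1 hxe
  have hUc : U.card = X.card - 2 * M.card := by
    rw [hUdef, card_sdiff_of_subset hUX, matching_card M hMd (fun e he => (hMX e he).2)]
  have hUM : ∀ x ∈ U, ∀ e ∈ M, x ∉ e := by
    intro x hx e he hxe
    exact (mem_sdiff.1 hx).2 (mem_biUnion.2 ⟨e, he, hxe⟩)
  have hind : ∀ x ∈ U, ∀ y ∈ U, ({x, y} : Finset V) ∉ F := by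
    intro x hx y hy hxy
    obtain ⟨h1, h2⟩ := aug M hMd {x, y} ⟨x, by simp⟩ (by
      intro e he
      rw [Finset.disjoint_left]
      intro z hz
      simp only [mem_insert, mem_singleton] at hz
      rcases hz with rfl | rfl
      · exact hUM _ hx e he
      · exact hUM _ hy e he)
    have := hmax _ (insert_subset hxy hMF) h1
    omega
  have haug : ∀ u v, u ≠ v → ({u, v} : Finset V) ∈ M → ∀ a ∈ U, ∀ b ∈ U, {u, a} ∈ F → {v, b} ∈ F → a = b := by
    intro u v huv he a ha b hb hua hvb
    by_contra hab
    set M0 := M.erase {u, v} with hM0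
    have hM0d : (M0 : Set (Finset V)).PairwiseDisjoint id := hMd.subset (by simp [hM0])
    have hM0c : M0.card + 1 = M.card := card_erase_add_one he
    have hdis : ∀ e' ∈ M0, Disjoint ({u, v} : Finset V) e' := by
      intro e' he'
      exact hMd he (mem_of_mem_erase he') (ne_of_mem_erase he').symm
    have hu : ∀ e' ∈ M0, u ∉ e' := fun e' he' => Finset.disjoint_left.1 (hdis e' he') (by simp)
    have hv : ∀ e' ∈ M0, v ∉ e' := fun e' he' => Finset.disjoint_left.1 (hdis e' he') (by simp)
    obtain ⟨h1, h2⟩ := aug M0 hM0d {v, b} ⟨v, by simp⟩ (by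
      intro e' he'
      rw [Finset.disjoint_left]
      intro z hz
      simp only [mem_insert, mem_singleton] at hz
      rcases hz with rfl | rfl
      · exact hv _ he'
      · exact hUM _ hb e' (mem_of_mem_erase he'))
    obtain ⟨h3, h4⟩ := aug _ h1 {u, a} ⟨u, by simp⟩ (by
      intro e' he'
      rw [Finset.disjoint_left]
      intro z hz
      simp only [mem_insert, mem_singleton] at hz
      rw [mem_insert] at he'
      rcases he' with rfl | he'
      · simp only [mem_insert, mem_singleton]
        rcases hz with rfl | rfl
        · rintro (h | rfl)
          · exact huv h
          · exact hUM _ hb _ he (by simp)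
        · rintro (rfl | h)
          · exact hUM _ ha _ he (by simp)
          · exact hab h
      · rcases hz with rfl | rfl
        · exact hu _ he'
        · exact hUM _ ha e' (mem_of_mem_erase he'))
    have := hmax (insert {u, a} (insert {v, b} M0)) (insert_subset hua (insert_subset hvb ((erase_subset _ _).trans hMF))) h3
    omega
  let good1 : Finset V → Prop := fun e => ∃ u v, e = {u, v} ∧ u ≠ v ∧ ∀ x ∈ U, {u, x} ∉ F
  have hdich : ∀ e ∈ M, ¬ good1 e → ∃ u v a, e = {u, v} ∧ u ≠ v ∧ a ∈ U ∧
      ∀ x ∈ U, x ≠ a → {u, x} ∉ F ∧ {v, x} ∉ F := by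
    intro e he hng
    obtain ⟨u, v, huv, rfl⟩ := card_eq_two.1 (hMX e he).2
    have hu : ∃ x ∈ U, {u, x} ∈ F := by
      by_contra h; push Not at h; exact hng ⟨u, v, rfl, huv, h⟩
    have hv : ∃ x ∈ U, {v, x} ∈ F := by
      by_contra h; push Not at h; exact hng ⟨v, u, pair_comm _ _, huv.symm, h⟩
    obtain ⟨a, ha, hua⟩ := hu
    obtain ⟨b, hb, hvb⟩ := hv
    have hab := haug u v huv he a ha b hb hua hvb
    refine ⟨u, v, a, rfl, huv, ha, fun x hx hxa => ⟨fun h => ?_, fun h => ?_⟩⟩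
    · exact hxa ((haug u v huv he x hx b hb h hvb).trans hab.symm)
    · exact hxa (haug u v huv he a ha x hx hua h).symm
  set M1 := M.filter good1 with hM1
  set M2 := M.filter (fun e => ¬ good1 e) with hM2
  have h1 : ∀ e ∈ M1, ∃ u v, e = {u, v} ∧ u ≠ v ∧ ∀ x ∈ U, {u, x} ∉ F := fun e he => (mem_filter.1 he).2
  have h2 : ∀ e ∈ M2, ∃ t : V × V × V, e = {t.1, t.2.1} ∧ t.1 ≠ t.2.1 ∧ t.2.2 ∈ U ∧
      ∀ x ∈ U, x ≠ t.2.2 → {t.1, x} ∉ F ∧ {t.2.1, x} ∉ F := by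
    intro e he
    obtain ⟨u, v, a, h⟩ := hdich e (mem_filter.1 he).1 (mem_filter.1 he).2
    exact ⟨(u, v, a), h⟩
  have h1' : ∀ e ∈ M1, ∃ b : V × V, e = {b.1, b.2} ∧ b.1 ≠ b.2 ∧ ∀ x ∈ U, {b.1, x} ∉ F := by
    intro e he
    obtain ⟨u, v, h⟩ := h1 e he
    exact ⟨(u, v), h⟩
  choose! g hg using h1'
  choose! h hh using h2
  have hM12 : M1.card + M2.card = M.card := card_filter_add_card_filter_not _
  have hM1M : ∀ e ∈ M1, e ∈ M := fun e he => (mem_filter.1 he).1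
  have hM2M : ∀ e ∈ M2, e ∈ M := fun e he => (mem_filter.1 he).1
  have hBc : (M1.image g).card = M1.card := by
    apply card_image_of_injOn
    intro e he e' he' hee
    rw [(hg e he).1, (hg e' he').1, hee]
  have hTc : (M2.image h).card = M2.card := by
    apply card_image_of_injOn
    intro e he e' he' hee
    rw [(hh e he).1, (hh e' he').1, hee]
  have hunc : unc X (M1.image g) (M2.image h) = U := by
    rw [unc, hUdef]
    congr 1
    rw [image_biUnion, image_biUnion]
    have e1 : M1.biUnion (fun a => {(g a).1, (g a).2}) = M1.biUnion id :=
      biUnion_congr rfl (fun e he => (hg e he).1.symm)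
    have e2 : M2.biUnion (fun a => {(h a).1, (h a).2.1}) = M2.biUnion id :=
      biUnion_congr rfl (fun e he => (hh e he).1.symm)
    rw [e1, e2, ← union_biUnion, hM1, hM2, filter_union_filter_not_eq]
  have hmiss : miss X (M1.image g) (M2.image h) = U.powersetCard 2 ∪
    (M1.biUnion (fun e => U.image (fun x => {(g e).1, x})) ∪
     M2.biUnion (fun e => (U.erase (h e).2.2).image (fun x => {(h e).1, x}) ∪
        (U.erase (h e).2.2).image (fun x => {(h e).2.1, x}))) := by
    rw [miss, hunc, image_biUnion, image_biUnion]
  have hg1 : ∀ e ∈ M1, (g e).1 ∈ e := fun e he => by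
    exact ((Finset.ext_iff.1 (hg e he).1) _).2 (by simp)
  have hg2 : ∀ e ∈ M1, (g e).2 ∈ e := fun e he => by
    exact ((Finset.ext_iff.1 (hg e he).1) _).2 (by simp)
  have hh1 : ∀ e ∈ M2, (h e).1 ∈ e := fun e he => by
    exact ((Finset.ext_iff.1 (hh e he).1) _).2 (by simp)
  have hh2 : ∀ e ∈ M2, (h e).2.1 ∈ e := fun e he => by
    exact ((Finset.ext_iff.1 (hh e he).1) _).2 (by simp)
  have hMU : ∀ e ∈ M, ∀ z ∈ e, z ∉ U := fun e he z hz hzU => hUM z hzU e he hz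
  have hUsub : U ⊆ X := sdiff_subset
  set S1 : Finset V → Finset (Finset V) := fun e => U.image (fun x => {(g e).1, x}) with hS1
  set S2 : Finset V → Finset (Finset V) := fun e => (U.erase (h e).2.2).image (fun x => {(h e).1, x}) ∪
        (U.erase (h e).2.2).image (fun x => {(h e).2.1, x}) with hS2
  have hS1f : ∀ e ∈ M1, ∀ s ∈ S1 e, ∃ z ∈ e, ∃ x ∈ U, s = {z, x} ∧ s ∉ F := by
    intro e he s hs
    obtain ⟨x, hx, rfl⟩ := mem_image.1 hs
    exact ⟨_, hg1 e he, x, hx, rfl, (hg e he).2.2 x hx⟩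
  have hS2f : ∀ e ∈ M2, ∀ s ∈ S2 e, ∃ z ∈ e, ∃ x ∈ U, s = {z, x} ∧ s ∉ F := by
    intro e he s hs
    rcases mem_union.1 hs with hs | hs
    · obtain ⟨x, hx, rfl⟩ := mem_image.1 hs
      rw [mem_erase] at hx
      exact ⟨_, hh1 e he, x, hx.2, rfl, ((hh e he).2.2.2 x hx.2 hx.1).1⟩
    · obtain ⟨x, hx, rfl⟩ := mem_image.1 hs
      rw [mem_erase] at hx
      exact ⟨_, hh2 e he, x, hx.2, rfl, ((hh e he).2.2.2 x hx.2 hx.1).2⟩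
  -- all members
  have hall : ∀ s ∈ M1.biUnion S1 ∪ M2.biUnion S2, ∃ e ∈ M, ∃ z ∈ e, ∃ x ∈ U, s = {z, x} ∧ s ∉ F := by
    intro s hs
    rcases mem_union.1 hs with hs | hs
    · obtain ⟨e, he, hs⟩ := mem_biUnion.1 hs
      exact ⟨e, hM1M e he, hS1f e he s hs⟩
    · obtain ⟨e, he, hs⟩ := mem_biUnion.1 hs
      exact ⟨e, hM2M e he, hS2f e he s hs⟩
  have huniq : ∀ e ∈ M, ∀ e' ∈ M, ∀ z ∈ e, ∀ z' ∈ e', ∀ x ∈ U, ∀ x' ∈ U, ({z, x} : Finset V) = {z', x'} → e = e' := by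
    intro e he e' he' z hz z' hz' x hx x' hx' hs
    have hzz : z = z' := pair_inj hs (fun h => hMU e he z hz (h ▸ hx'))
    by_contra hne
    exact Finset.disjoint_left.1 (hMd he he' hne) hz (hzz ▸ hz')
  refine ⟨M1.image g, M2.image h, ?_, ?_, by rw [hBc, hTc, hM12], ?_, ?_, ?_⟩
  · intro b hb
    obtain ⟨e, he, rfl⟩ := mem_image.1 hb
    have := (hMX e (hM1M e he)).1
    exact mem_product.2 ⟨this (hg1 e he), this (hg2 e he)⟩
  · intro b hb
    obtain ⟨e, he, rfl⟩ := mem_image.1 hb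
    have := (hMX e (hM2M e he)).1
    exact mem_product.2 ⟨this (hh1 e he), mem_product.2 ⟨this (hh2 e he), hUsub (hh e he).2.2.1⟩⟩
  · rw [hmiss, Finset.disjoint_left]
    intro s hsF hs
    rcases mem_union.1 hs with hs | hs
    · rw [mem_powersetCard] at hs
      obtain ⟨x, y, hxy, rfl⟩ := card_eq_two.1 hs.2
      exact hind x (hs.1 (by simp)) y (hs.1 (by simp)) hsF
    · obtain ⟨e, he, z, hz, x, hx, _, hnF⟩ := hall s hs
      exact hnF hsF
  · rw [hmiss]
    intro s hs
    rw [mem_powersetCard]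
    rcases mem_union.1 hs with hs | hs
    · rw [mem_powersetCard] at hs
      exact ⟨hs.1.trans hUsub, hs.2⟩
    · obtain ⟨e, he, z, hz, x, hx, rfl, hnF⟩ := hall s hs
      refine ⟨?_, card_pair (fun h => hMU e he z hz (h ▸ hx))⟩
      intro y hy
      simp only [mem_insert, mem_singleton] at hy
      rcases hy with rfl | rfl
      · exact (hMX e he).1 hz
      · exact hUsub hx
  · rw [hmiss, card_union_of_disjoint, card_union_of_disjoint, card_biUnion, card_biUnion, card_powersetCard,
      hBc, hTc, ← hUc]
    · have c1 : ∀ e ∈ M1, (S1 e).card = U.card := fun e he =>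
        image_pair_card U _ (hMU e (hM1M e he) _ (hg1 e he))
      have c2 : ∀ e ∈ M2, (S2 e).card = 2 * (U.card - 1) := by
        intro e he
        have n1 := hMU e (hM2M e he) _ (hh1 e he)
        have n2 := hMU e (hM2M e he) _ (hh2 e he)
        simp only [hS2]
        rw [card_union_of_disjoint, image_pair_card _ _ (fun h => n1 (mem_of_mem_erase h)),
          image_pair_card _ _ (fun h => n2 (mem_of_mem_erase h)), card_erase_of_mem (hh e he).2.2.1]
        · ring
        · rw [Finset.disjoint_left]
          intro s hs hs'
          obtain ⟨x, hx, rfl⟩ := mem_image.1 hs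
          obtain ⟨y, hy, hxy⟩ := mem_image.1 hs'
          exact (hh e he).2.1 (pair_inj hxy.symm (fun h => n1 (h ▸ mem_of_mem_erase hy)))
      rw [sum_congr rfl c1, sum_congr rfl c2, sum_const, sum_const, smul_eq_mul, smul_eq_mul]
      ring
    · intro e he e' he' hne
      change Disjoint _ _
      rw [Finset.disjoint_left]
      intro s hs hs'
      obtain ⟨z, hz, x, hx, rfl, _⟩ := hS2f e he s hs
      obtain ⟨z', hz', x', hx', heq, _⟩ := hS2f e' he' _ hs'
      exact hne (huniq e (hM2M e he) e' (hM2M e' he') z hz z' hz' x hx x' hx' heq)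
    · intro e he e' he' hne
      change Disjoint _ _
      rw [Finset.disjoint_left]
      intro s hs hs'
      obtain ⟨z, hz, x, hx, rfl, _⟩ := hS1f e he s hs
      obtain ⟨z', hz', x', hx', heq, _⟩ := hS1f e' he' _ hs'
      exact hne (huniq e (hM1M e he) e' (hM1M e' he') z hz z' hz' x hx x' hx' heq)
    · rw [Finset.disjoint_left]
      intro s hs hs'
      obtain ⟨e, he, hs⟩ := mem_biUnion.1 hs
      obtain ⟨e', he', hs'⟩ := mem_biUnion.1 hs'
      obtain ⟨z, hz, x, hx, rfl, _⟩ := hS1f e he s hs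
      obtain ⟨z', hz', x', hx', heq, _⟩ := hS2f e' he' _ hs'
      have := huniq e (hM1M e he) e' (hM2M e' he') z hz z' hz' x hx x' hx' heq
      subst this
      exact (mem_filter.1 he').2 (mem_filter.1 he).2
    · rw [Finset.disjoint_left]
      intro s hs hs'
      obtain ⟨e, he, z, hz, x, hx, rfl, _⟩ := hall s hs'
      rw [mem_powersetCard] at hs
      exact hMU e he z hz (hs.1 (by simp))

lemma sum_small {W : Type*} [DecidableEq W] (Z : Finset W) (k : ℕ) (hZ : 1 ≤ Z.card) :
    ∑ B ∈ Z.powerset.filter (fun B => B.card < k), ((Z.card : ℝ) ^ B.card)⁻¹ ≤ k := by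
  have hZ' : (0:ℝ) < Z.card := by exact_mod_cast hZ
  rw [← sum_fiberwise_of_maps_to (s := Z.powerset.filter (fun B => B.card < k)) (t := range k)
    (g := fun B => B.card) (fun B hB => mem_range.2 (mem_filter.1 hB).2)]
  calc _ ≤ ∑ l ∈ range k, (1:ℝ) := by
        apply sum_le_sum
        intro l hl
        have e1 : ∀ B ∈ (Z.powerset.filter (fun B => B.card < k)).filter (fun B => B.card = l),
            ((Z.card : ℝ) ^ B.card)⁻¹ = ((Z.card : ℝ) ^ l)⁻¹ := by
          intro B hB
          rw [(mem_filter.1 hB).2]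
        rw [sum_congr rfl e1, sum_const, nsmul_eq_mul]
        have h1 : ((Z.powerset.filter (fun B => B.card < k)).filter (fun B => B.card = l)).card ≤ Z.card ^ l := by
          refine le_trans (card_le_card (t := Z.powersetCard l) ?_) ?_
          · intro B hB
            rw [mem_filter, mem_filter, mem_powerset] at hB
            exact mem_powersetCard.2 ⟨hB.1.1, hB.2⟩
          · rw [card_powersetCard]; exact Nat.choose_le_pow _ _
        rw [← div_eq_mul_inv, div_le_one (by positivity)]
        exact_mod_cast h1
    _ = k := by simp

lemma N_lower (n l t : ℕ) (h : 4 * (l + t + 1) ≤ n) :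
    ((n:ℝ) ^ 2 / 4 + t * n / 2) ≤
      (((n - 2 * (l + t)).choose 2 + l * (n - 2 * (l + t)) + t * (2 * (n - 2 * (l + t) - 1)) : ℕ) : ℝ) := by
  have h' : (4:ℝ) * (l + t + 1) ≤ n := by exact_mod_cast h
  have e1 : ((n - 2 * (l + t) - 1 : ℕ) : ℝ) = n - 2 * (l + t) - 1 := by
    rw [Nat.cast_sub (by omega), Nat.cast_sub (by omega)]; push_cast; ring
  have e2 : ((n - 2 * (l + t) : ℕ) : ℝ) = n - 2 * (l + t) := by
    rw [Nat.cast_sub (by omega)]; push_cast; ring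
  push_cast [Nat.cast_choose_two]
  rw [e1, e2]
  have hl : (0:ℝ) ≤ l := by positivity
  have ht : (0:ℝ) ≤ t := by positivity
  have hk : (n:ℝ) / 2 + 2 ≤ n - 2 * (l + t) := by linarith
  have e3 : ((n:ℝ) - 2 * (l + t)) * (n - 2 * (l + t) - 1) / 2 + l * (n - 2 * (l + t)) + t * (2 * (n - 2 * (l + t) - 1))
    = (n - 2 * (l + t)) * (n - 1) / 2 + t * ((n - 2 * (l + t)) - 2) := by ring
  rw [e3]
  have h5 := mul_le_mul_of_nonneg_right hk (show (0:ℝ) ≤ n - 1 by linarith)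
  have h6 := mul_le_mul_of_nonneg_left hk ht
  nlinarith

lemma matching_prob {V : Type*} [DecidableEq V] (X : Finset V) (h2 : 2 ≤ X.card) (α δ : ℝ)
    (hα0 : 0 < α) (hδ0 : 0 < δ) (hδ : δ < 1) (good : Finset (Finset V) → Prop)
    (hgood : ∀ F ⊆ X.powersetCard 2,
      (∃ M ⊆ F, M.card = X.card / 4 ∧ (M : Set (Finset V)).PairwiseDisjoint id) → good F) :
    1 - δ ≤ ∑ F ∈ (X.powersetCard 2).powerset,
        (if good F then (pEdge X.card α δ) ^ F.card
            * (1 - pEdge X.card α δ) ^ ((X.powersetCard 2).card - F.card) else 0) := by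
  have hNe : Nonempty V := by
    obtain ⟨x, _⟩ := card_pos.1 (show 0 < X.card by omega)
    exact ⟨x⟩
  set n := X.card with hn
  have hn2 : (2:ℝ) ≤ n := by exact_mod_cast h2
  have hn0 : (0:ℝ) < n := by linarith
  have hlogn : 0 ≤ Real.log n := Real.log_nonneg (by linarith)
  have hlogd : 0 ≤ Real.log (2 / δ) := Real.log_nonneg (by rw [le_div_iff₀ hδ0]; linarith)
  set p' := 2 * Real.log n / (n : ℝ) ^ (1 - α) + 4 * Real.log (2 / δ) / (n : ℝ) ^ (2 - α) with hp'
  have hp'0 : 0 ≤ p' := by positivity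
  have hpl : 2 * Real.log n / n + 4 * Real.log (2 / δ) / (n:ℝ) ^ 2 ≤ p' := by
    have h1 : (n:ℝ) ^ (1 - α) ≤ n := by
      calc (n:ℝ) ^ (1 - α) ≤ (n:ℝ) ^ (1:ℝ) := Real.rpow_le_rpow_of_exponent_le (by linarith) (by linarith)
        _ = n := Real.rpow_one _
    have h3 : (n:ℝ) ^ (2 - α) ≤ (n:ℝ) ^ 2 := by
      calc (n:ℝ) ^ (2 - α) ≤ (n:ℝ) ^ (2:ℝ) := Real.rpow_le_rpow_of_exponent_le (by linarith) (by linarith)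
        _ = (n:ℝ) ^ 2 := by norm_num
    rw [hp']
    gcongr
  have hpE : pEdge n α δ = min p' 1 := rfl
  rw [hpE]
  set k := n / 4 with hk
  let A : Finset (V × V) × Finset (V × V × V) → Finset (Finset V) := fun a => miss X a.1 a.2
  let I := (((X ×ˢ X).powerset.filter (fun B => B.card < k)) ×ˢ
      ((X ×ˢ (X ×ˢ X)).powerset.filter (fun B => B.card < k))).filter
    (fun a => a.1.card + a.2.card < k ∧ A a ⊆ X.powersetCard 2 ∧
      (A a).card = (n - 2 * (a.1.card + a.2.card)).choose 2 + a.1.card * (n - 2 * (a.1.card + a.2.card))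
        + a.2.card * (2 * (n - 2 * (a.1.card + a.2.card) - 1)))
  have hub := union_bound (X.powersetCard 2) (min p' 1) (le_min hp'0 zero_le_one) (min_le_right _ _)
    good I A ?_ ?_
  · refine le_trans ?_ hub
    have hc1 : ((X ×ˢ X).card : ℝ) = (n:ℝ) ^ 2 := by rw [card_product]; push_cast; ring
    have hc2 : ((X ×ˢ (X ×ˢ X)).card : ℝ) = (n:ℝ) ^ 3 := by
      rw [card_product, card_product]; push_cast; ring
    have hterm : ∀ a ∈ I, (1 - min p' 1) ^ (A a).card ≤
        (δ / 2 * ((n:ℝ) ^ 2)⁻¹) * ((((X ×ˢ X).card : ℝ) ^ a.1.card)⁻¹ * (((X ×ˢ (X ×ˢ X)).card : ℝ) ^ a.2.card)⁻¹) := by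
      intro a ha
      obtain ⟨hlt, _, hcard⟩ := (mem_filter.1 ha).2
      set l := a.1.card
      set t := a.2.card
      have h4 : 4 * (l + t + 1) ≤ n := by omega
      have hN := N_lower n l t h4
      rw [← hcard] at hN
      have hpos : (0:ℝ) < (n:ℝ) ^ 2 / 4 + t * n / 2 := by positivity
      have h1 : 1 ≤ (A a).card := by
        have : (0:ℝ) < (A a).card := hpos.trans_le hN
        exact_mod_cast this
      refine (qpow p' _ _ hp'0 h1 hN).trans ?_
      have h5 : (2 * Real.log n / n + 4 * Real.log (2 / δ) / (n:ℝ) ^ 2) * ((n:ℝ) ^ 2 / 4 + t * n / 2)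
          ≤ p' * ((n:ℝ) ^ 2 / 4 + t * n / 2) := by gcongr
      have h6 : (2 * Real.log n / n + 4 * Real.log (2 / δ) / (n:ℝ) ^ 2) * ((n:ℝ) ^ 2 / 4 + t * n / 2)
          = Real.log n * (n / 2 + t) + Real.log (2 / δ) + 2 * t * Real.log (2 / δ) / n := by
        field_simp
        ring
      have h7 : 0 ≤ 2 * t * Real.log (2 / δ) / n := by positivity
      have h8 : ((2 * l + 3 * t + 2 : ℕ) : ℝ) ≤ n / 2 + t := by
        have : (4:ℝ) * (l + t + 1) ≤ n := by exact_mod_cast h4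
        push_cast
        linarith
      have h9 := mul_le_mul_of_nonneg_left h8 hlogn
      have h10 : ((2 * l + 3 * t + 2 : ℕ) : ℝ) * Real.log n + Real.log (2 / δ) ≤ p' * ((n:ℝ) ^ 2 / 4 + t * n / 2) := by
        linarith
      refine (Real.exp_le_exp.2 (neg_le_neg h10)).trans (le_of_eq ?_)
      rw [Real.exp_neg, Real.exp_add, Real.exp_nat_mul, Real.exp_log hn0, Real.exp_log (by positivity),
        hc1, hc2, ← pow_mul, ← pow_mul, pow_add, pow_add, mul_inv, mul_inv, mul_inv, inv_div]
      ring
    have hs := sum_le_sum hterm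
    have hs2 : ∑ a ∈ I, ((((X ×ˢ X).card : ℝ) ^ a.1.card)⁻¹ * (((X ×ˢ (X ×ˢ X)).card : ℝ) ^ a.2.card)⁻¹) ≤ (n:ℝ) ^ 2 := by
      refine (sum_le_sum_of_subset_of_nonneg (filter_subset _ _) (fun _ _ _ => by positivity)).trans ?_
      rw [sum_product]
      simp only
      rw [← sum_mul_sum]
      have hX1 : 1 ≤ (X ×ˢ X).card := by rw [card_product]; nlinarith
      have hX2 : 1 ≤ (X ×ˢ (X ×ˢ X)).card := by
        rw [card_product]; nlinarith
      have hkn : (k:ℝ) ≤ n := by exact_mod_cast Nat.div_le_self n 4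
      have b1 := (sum_small (X ×ˢ X) k hX1).trans hkn
      have b2 := (sum_small (X ×ˢ (X ×ˢ X)) k hX2).trans hkn
      rw [sq]
      exact mul_le_mul b1 b2 (sum_nonneg fun _ _ => by positivity) hn0.le
    rw [← mul_sum] at hs
    have h3 : (δ / 2 * ((n:ℝ) ^ 2)⁻¹) * ∑ a ∈ I, ((((X ×ˢ X).card : ℝ) ^ a.1.card)⁻¹ * (((X ×ˢ (X ×ˢ X)).card : ℝ) ^ a.2.card)⁻¹)
        ≤ (δ / 2 * ((n:ℝ) ^ 2)⁻¹) * (n:ℝ) ^ 2 := by gcongr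
    have h33 : (δ / 2 * ((n:ℝ) ^ 2)⁻¹) * (n:ℝ) ^ 2 = δ / 2 := by field_simp
    linarith
  · intro a ha
    exact (mem_filter.1 ha).2.2.1
  · intro F hF hng
    obtain ⟨M, hM, hmax⟩ := exists_max_image
      (F.powerset.filter (fun M : Finset (Finset V) => (M : Set (Finset V)).PairwiseDisjoint id)) card
      ⟨∅, by simp⟩
    rw [mem_filter, mem_powerset] at hM
    have hlt : M.card < k := by
      by_contra hge
      push Not at hge
      obtain ⟨M', hM', hc⟩ := exists_subset_card_eq hge
      exact hng (hgood F hF ⟨M', hM'.trans hM.1, hc, hM.2.subset (by exact_mod_cast hM')⟩)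
    obtain ⟨B, T, hB, hT, hBT, hdis, hsub, hcard⟩ := structure_lem X F hF M hM.1 hM.2
      (fun M' h h' => hmax M' (by rw [mem_filter, mem_powerset]; exact ⟨h, h'⟩))
    refine ⟨(B, T), ?_, hdis⟩
    rw [mem_filter, mem_product, mem_filter, mem_filter, mem_powerset, mem_powerset]
    refine ⟨⟨⟨hB, ?_⟩, hT, ?_⟩, ?_, hsub, ?_⟩
    · simp only; omega
    · simp only; omega
    · simp only; omega
    · simp only [hBT]; exact hcard

/-- first part of Theorem 1.5. For any `c > 0`, `d ≥ 1` there is a constant `C`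
such that: for a set system with dual shatter function at most `c·k^d` and `n ≥ 2`, if each of
the `C(n,2)` edges is kept independently with probability `pEdge n α δ`, then with probability at
least `1 − δ` the sampled edge set contains a matching of size `⌊n/4⌋` with crossing number at
most `C·(n^{1−α/d} + ln|𝒮|)`. The probability of the good event is written out as the sum, over
subsets `F` of the edge set, of the Bernoulli product weight of `F`. -/
theorem stmt_10 (c d : ℝ) (hc : 0 < c) (hd : 1 ≤ d) :
    ∃ C : ℝ, ∀ (V : Type) [DecidableEq V], ∀ (X : Finset V) (𝒮 : Finset (Finset V)),
      (∀ S ∈ 𝒮, S ⊆ X) → 2 ≤ X.card →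
      (∀ R ⊆ 𝒮, R.Nonempty →
        ((X.image fun x => R.filter fun r => x ∈ r).card : ℝ) ≤ c * (R.card : ℝ) ^ d) →
      ∀ α δ : ℝ, 0 < α → α ≤ 1 → 0 < δ → δ < 1 →
      1 - δ ≤ ∑ F ∈ (X.powersetCard 2).powerset,
        (if ∃ M ⊆ F, M.card = X.card / 4 ∧ (M : Set (Finset V)).PairwiseDisjoint id ∧
              ∀ S ∈ 𝒮, ((M.filter fun e => (S ∩ e).card = 1).card : ℝ) ≤
                C * ((X.card : ℝ) ^ (1 - α / d) + Real.log 𝒮.card)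
          then (pEdge X.card α δ) ^ F.card
            * (1 - pEdge X.card α δ) ^ ((X.powersetCard 2).card - F.card)
          else 0) := by
  obtain ⟨d0, hd0, hI⟩ := exists_d0 c d
  have hd1 : 0 < d := by linarith
  set a : ℝ := (32 * c) ^ (1 / d) with ha
  have ha0 : 0 < a := by positivity
  refine ⟨a + (4 * d0 * a + 2), ?_⟩
  intro V _ X 𝒮 hSX h2 hS α δ hα0 hα hδ0 hδ
  obtain ⟨good, hgd⟩ : ∃ good : Finset (Finset V) → Prop, ∀ F, good F ↔ ∃ M ⊆ F, M.card = X.card / 4 ∧ (M : Set (Finset V)).PairwiseDisjoint id ∧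
              ∀ S ∈ 𝒮, ((M.filter fun e => (S ∩ e).card = 1).card : ℝ) ≤
                (a + (4 * d0 * a + 2)) * ((X.card : ℝ) ^ (1 - α / d) + Real.log 𝒮.card) :=
    ⟨_, fun _ => Iff.rfl⟩
  suffices hsuff : 1 - δ ≤ ∑ F ∈ (X.powersetCard 2).powerset,
        (if good F then (pEdge X.card α δ) ^ F.card
            * (1 - pEdge X.card α δ) ^ ((X.powersetCard 2).card - F.card) else 0) by
    refine hsuff.trans (le_of_eq (sum_congr rfl fun F _ => ?_))
    by_cases hF : good F
    · rw [if_pos hF, if_pos ((hgd F).1 hF)]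
    · rw [if_neg hF, if_neg (fun h => hF ((hgd F).2 h))]
  have hn2 : (2:ℝ) ≤ X.card := by exact_mod_cast h2
  have hn0 : (0:ℝ) < X.card := by linarith
  set n : ℝ := (X.card : ℝ) with hn
  have hP : 0 < n ^ (1 - α / d) := by positivity
  have hlog : 0 ≤ Real.log (𝒮.card : ℝ) := Real.log_natCast_nonneg _
  have hd0' : (1:ℝ) ≤ d0 := by exact_mod_cast hd0
  have hkn : ((X.card / 4 : ℕ) : ℝ) ≤ n / 4 := by
    have := @Nat.cast_div_le ℝ _ _ _ X.card 4
    exact_mod_cast this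
  -- n = n^(1-α/d) * (n^α)^(1/d)
  have hnn : n ^ (1 - α / d) * (n ^ α) ^ (1 / d) = n := by
    rw [← Real.rpow_mul hn0.le, ← Real.rpow_add hn0]
    rw [show 1 - α / d + α * (1 / d) = 1 by ring, Real.rpow_one]
  rcases 𝒮.eq_empty_or_nonempty with hemp | hne
  · apply matching_prob X h2 α δ hα0 hδ0 hδ good
    rintro F hF ⟨M, hMF, hMc, hMd⟩
    rw [hgd]
    refine ⟨M, hMF, hMc, hMd, ?_⟩
    intro S hSS
    rw [hemp] at hSS
    exact absurd hSS (notMem_empty S)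
  rcases lt_or_ge (n ^ α) (32 * c) with hreg | hreg
  · apply matching_prob X h2 α δ hα0 hδ0 hδ good
    rintro F hF ⟨M, hMF, hMc, hMd⟩
    rw [hgd]
    refine ⟨M, hMF, hMc, hMd, ?_⟩
    intro S hSS
    have h1 : ((M.filter fun e => (S ∩ e).card = 1).card : ℝ) ≤ n / 4 := by
      refine le_trans ?_ hkn
      rw [← hMc]
      exact_mod_cast card_filter_le _ _
    have h3 : (n ^ α) ^ (1 / d) ≤ a := Real.rpow_le_rpow (by positivity) hreg.le (by positivity)
    have h4 : n ≤ n ^ (1 - α / d) * a := by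
      calc n = n ^ (1 - α / d) * (n ^ α) ^ (1 / d) := hnn.symm
        _ ≤ _ := by gcongr
    have h5 : a * n ^ (1 - α / d) ≤ (a + (4 * d0 * a + 2)) * (n ^ (1 - α / d) + Real.log 𝒮.card) := by
      apply mul_le_mul _ _ hP.le (by positivity)
      · have : 0 ≤ 4 * d0 * a + 2 := by positivity
        linarith
      · linarith
    linarith
  · apply color_prob X h2 α δ hα hδ0 hδ good
    intro F hF hgood
    set s : ℕ := ⌊(n ^ α / (32 * c)) ^ (1 / d)⌋₊ with hs
    have hb1 : 1 ≤ n ^ α / (32 * c) := by rw [le_div_iff₀ (by positivity)]; linarith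
    have hs1 : 1 ≤ s := by
      rw [hs, Nat.one_le_floor_iff]
      exact Real.one_le_rpow hb1 (by positivity)
    have hsle : (s:ℝ) ≤ (n ^ α / (32 * c)) ^ (1 / d) := Nat.floor_le (by positivity)
    have hslt : (n ^ α / (32 * c)) ^ (1 / d) < s + 1 := Nat.lt_floor_add_one _
    have hm : 2 * (c * (s:ℝ) ^ d) ≤ n ^ α / 16 := by
      have : (s:ℝ) ^ d ≤ n ^ α / (32 * c) := by
        calc (s:ℝ) ^ d ≤ ((n ^ α / (32 * c)) ^ (1 / d)) ^ d := Real.rpow_le_rpow (by positivity) hsle hd1.le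
          _ = _ := by
            rw [← Real.rpow_mul (by positivity), one_div_mul_cancel hd1.ne', Real.rpow_one]
      calc 2 * (c * (s:ℝ) ^ d) ≤ 2 * (c * (n ^ α / (32 * c))) := by gcongr
        _ = _ := by field_simp; norm_num
    obtain ⟨M, hMF, hMc, hMd, hsum⟩ := greedy c d hc hd d0 hd0 hI X 𝒮 hS hne s hs1 _ hm F hF hgood _ le_rfl
    rw [hgd]
    refine ⟨M, hMF, hMc, hMd, ?_⟩
    intro S hSS
    have h1 := greedy_final 𝒮 M _ _ (by positivity) hsum S hSS
    refine h1.trans ?_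
    have h3 : n / (s + 1) ≤ a * n ^ (1 - α / d) := by
      rw [div_le_iff₀ (by positivity)]
      have e : (n ^ α) ^ (1 / d) = a * (n ^ α / (32 * c)) ^ (1 / d) := by
        rw [ha, ← Real.mul_rpow (by positivity) (by positivity)]
        congr 1
        field_simp
      calc n = n ^ (1 - α / d) * (n ^ α) ^ (1 / d) := hnn.symm
        _ = a * n ^ (1 - α / d) * (n ^ α / (32 * c)) ^ (1 / d) := by rw [e]; ring
        _ ≤ _ := by gcongr
    have h4 : 2 * (4 * (d0:ℝ) / (s + 1)) * ((X.card / 4 : ℕ) : ℝ) ≤ 2 * d0 * (a * n ^ (1 - α / d)) := by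
      calc _ ≤ 2 * (4 * (d0:ℝ) / (s + 1)) * (n / 4) := by gcongr
        _ = 2 * d0 * (n / (s + 1)) := by ring
        _ ≤ _ := by gcongr
    have h5 : 0 ≤ a * n ^ (1 - α / d) := by positivity
    have h6 : 0 ≤ (a + 4 * d0 * a) * Real.log 𝒮.card := by positivity
    nlinarith
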